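/- Let S be an almost tilting object in the cluster category CC_Q and let M and M* be its two complements. Then exactly one of the following holds: M is split projective in Gen(M ⊕ S), or M* is split projective in Gen(M* ⊕ S). -/

import Mathlib

open CategoryTheory CategoryTheory.Limits ZeroObject

attribute [local instance] CategoryTheory.Abelian.hasFiniteBiproducts

noncomputable section

namespace NCPaper

/-- A finite quiver without oriented cycles. -/
structure FinQuiver : Type 1 where
  V : Type
  [quiver : Quiver.{0} V]
  [fintypeV : Fintype V]
  [fintypeArr : ∀ a b : V, Fintype (a ⟶ b)]
  acyclic : ∀ (v : V) (p : Quiver.Path v v), p = Quiver.Path.nil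

attribute [instance] FinQuiver.quiver FinQuiver.fintypeV FinQuiver.fintypeArr

variable (k : Type) [Field k] (Q : FinQuiver)

/-- The ambient abelian category of all `k`-linear representations of `Q`;
finite-dimensional representations are singled out by the predicate `FinDim`. -/
abbrev RepC : Type 1 := Paths Q.V ⥤ ModuleCat.{0} k

variable {k Q}

/-- `M` is a finite-dimensional representation, i.e. an object of `rep Q`. -/
def FinDim (M : RepC k Q) : Prop :=
  ∀ v : Q.V, FiniteDimensional k (M.obj ((Paths.of Q.V).obj v))

section Cat

variable {C : Type*} [Category C] [Abelian C]

/-- `X` is a direct summand of `A`. -/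
def IsSummand (X A : C) : Prop := ∃ (i : X ⟶ A) (r : A ⟶ X), i ≫ r = 𝟙 X

/-- The additive closure of a set of objects: direct summands of finite direct sums. -/
def addSet (S : Set C) : Set C :=
  { X | ∃ (n : ℕ) (f : Fin n → C), (∀ i, f i ∈ S) ∧ IsSummand X (⨁ f) }

/-- `Gen S`: all quotients of objects of the additive closure of `S`. -/
def gen (S : Set C) : Set C := { X | ∃ A ∈ addSet S, ∃ p : A ⟶ X, Epi p }

/-- All morphisms from `A` to `B` vanish. -/
def HomZero (A B : C) : Prop := ∀ f : A ⟶ B, f = 0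

/-- `Ext¹(A, B) = 0`, expressed by the splitting of all short exact sequences
`0 ⟶ B ⟶ E ⟶ A ⟶ 0`. -/
def Ext1Zero (A B : C) : Prop :=
  ∀ (E : C) (i : B ⟶ E) (p : E ⟶ A) (w : i ≫ p = 0),
    (ShortComplex.mk i p w).ShortExact → ∃ r : E ⟶ B, i ≫ r = 𝟙 B

/-- An indecomposable object. -/
def Indec (X : C) : Prop :=
  ¬ IsZero X ∧ ∀ (A B : C), (X ≅ A ⊞ B) → IsZero A ∨ IsZero B

/-- A torsion class: a full subcategory (identified with its set of objects) closed under
direct sums, direct summands, quotients and extensions. -/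
structure IsTorsionClass (T : Set C) : Prop where
  zero_mem : (0 : C) ∈ T
  sum_mem : ∀ X ∈ T, ∀ Y ∈ T, (X ⊞ Y : C) ∈ T
  summand_mem : ∀ X ∈ T, ∀ Y : C, IsSummand Y X → Y ∈ T
  quot_mem : ∀ X ∈ T, ∀ (Y : C) (p : X ⟶ Y), Epi p → Y ∈ T
  ext_mem : ∀ S : ShortComplex C, S.ShortExact → S.X₁ ∈ T → S.X₃ ∈ T → S.X₂ ∈ T

/-- A wide subcategory: a full subcategory (closed under direct sums and summands)
which is exact abelian (closed under kernels and cokernels) and closed under extensions. -/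
structure IsWide (A : Set C) : Prop where
  zero_mem : (0 : C) ∈ A
  sum_mem : ∀ X ∈ A, ∀ Y ∈ A, (X ⊞ Y : C) ∈ A
  summand_mem : ∀ X ∈ A, ∀ Y : C, IsSummand Y X → Y ∈ A
  ker_mem : ∀ X ∈ A, ∀ Y ∈ A, ∀ f : X ⟶ Y, (kernel f : C) ∈ A
  coker_mem : ∀ X ∈ A, ∀ Y ∈ A, ∀ f : X ⟶ Y, (cokernel f : C) ∈ A
  ext_mem : ∀ S : ShortComplex C, S.ShortExact → S.X₁ ∈ A → S.X₃ ∈ A → S.X₂ ∈ A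

/-- `P` is split projective in the subcategory `T`: every epimorphism onto `P`
from an object of `T` splits. -/
def SplitProjIn (T : Set C) (P : C) : Prop :=
  P ∈ T ∧ ∀ X ∈ T, ∀ p : X ⟶ P, Epi p → ∃ s : P ⟶ X, s ≫ p = 𝟙 P

/-- `P` is Ext-projective in the subcategory `T`. -/
def ExtProjIn (T : Set C) (P : C) : Prop := P ∈ T ∧ ∀ X ∈ T, Ext1Zero P X

/-- The subcategory `a(T)` associated to a torsion class `T`. -/
def aSet (T : Set C) : Set C :=
  { B | B ∈ T ∧ ∀ Y ∈ T, ∀ g : Y ⟶ B, (kernel g : C) ∈ T }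

/-- A subcategory is finitely generated if it is generated by a single object of it. -/
def IsFinGen (T : Set C) : Prop := ∃ U ∈ T, T ⊆ gen {U}

/-- `U` is a generator of the subcategory `T`. -/
def IsGenerator (T : Set C) (U : C) : Prop := U ∈ T ∧ T ⊆ gen {U}

/-- `X` is a subquotient of `M`. -/
def IsSubquotient (X M : C) : Prop := ∃ (N : C) (i : N ⟶ M) (p : N ⟶ X), Mono i ∧ Epi p

/-- The support of `M` is contained in the support of `C0`: every simple subquotient
(composition factor) of `M` is a composition factor of `C0`. -/
def SuppLE (M C0 : C) : Prop := ∀ S : C, Simple S → IsSubquotient S M → IsSubquotient S C0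

/-- A partial tilting object of a hereditary category. -/
def IsPartialTilting (T : C) : Prop := Ext1Zero T T

/-- `T` is a tilting object of the full subcategory `A`: it is self-orthogonal and every
(split) projective object of `A` admits a coresolution `0 ⟶ P ⟶ T' ⟶ T'' ⟶ 0` with
`T', T'' ∈ add T`. For `A` the subcategory of representations supported on `supp T`,
this says exactly that `T` is a tilting `kQ/ann T`-module. -/
def TiltingIn (A : Set C) (T : C) : Prop :=
  T ∈ A ∧ Ext1Zero T T ∧
    ∀ P : C, SplitProjIn A P →
      ∃ (T' T'' : C) (_ : T' ∈ addSet {T}) (_ : T'' ∈ addSet {T})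
        (i : P ⟶ T') (p : T' ⟶ T'') (w : i ≫ p = 0),
        (ShortComplex.mk i p w).ShortExact


/-- `U` is the direct sum of one representative of each isomorphism class of
indecomposable Ext-projective objects of `T`. -/
def IsExtProjSum (T : Set C) (U : C) : Prop :=
  ∃ (n : ℕ) (f : Fin n → C),
    (∀ i, Indec (f i) ∧ ExtProjIn T (f i)) ∧
    (∀ i j, Nonempty (f i ≅ f j) → i = j) ∧
    (∀ P : C, Indec P → ExtProjIn T P → ∃ i, Nonempty (P ≅ f i)) ∧
    Nonempty (U ≅ ⨁ f)

/-- A basic object: a direct sum of pairwise non-isomorphic indecomposables. -/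
def IsBasic (U : C) : Prop :=
  ∃ (n : ℕ) (f : Fin n → C), (∀ i, Indec (f i)) ∧
    (∀ i j, Nonempty (f i ≅ f j) → i = j) ∧ Nonempty (U ≅ ⨁ f)

end Cat

/-- A support tilting object of `rep Q`: partial tilting, and tilting as a
`kQ/ann T`-module, i.e. tilting in the subcategory of all finite-dimensional
representations supported on the support of `T`. -/
def IsSupportTilting {k : Type} [Field k] {Q : FinQuiver} (T : RepC k Q) : Prop :=
  IsPartialTilting T ∧ TiltingIn { M : RepC k Q | FinDim M ∧ SuppLE M T } T

section Comb

/-- The dimension vector of a representation. -/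
def dimVec {k : Type} [Field k] {Q : FinQuiver} (M : RepC k Q) : Q.V → ℤ :=
  fun v => (Module.finrank k (M.obj ((Paths.of Q.V).obj v)) : ℤ)

/-- The Euler form of the quiver `Q`. -/
def euler (Q : FinQuiver) {R : Type} [CommRing R] (α β : Q.V → R) : R :=
  (∑ v : Q.V, α v * β v) - ∑ a : (Σ x : Q.V, Σ y : Q.V, x ⟶ y), α a.1 * β a.2.1

/-- The symmetrized Euler form of the quiver `Q`. -/
def symEuler (Q : FinQuiver) {R : Type} [CommRing R] (α β : Q.V → R) : R :=
  euler Q α β + euler Q β α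

/-- The reflection in the vector `v`: `s_v(w) = w - (v, w)·v`. -/
def reflV (Q : FinQuiver) (v : Q.V → ℤ) : (Q.V → ℤ) → (Q.V → ℤ) :=
  fun w => w - symEuler Q v w • v

/-- The composition (product, written from left to right) of a finite sequence of
linear transformations. -/
def comps (Q : FinQuiver) {m : ℕ} (g : Fin m → ((Q.V → ℤ) → (Q.V → ℤ))) :
    (Q.V → ℤ) → (Q.V → ℤ) :=
  (List.ofFn g).foldr (· ∘ ·) id

open scoped Classical in
/-- The simple root at a vertex. -/
def simRoot (Q : FinQuiver) (v : Q.V) : Q.V → ℤ := fun w => if w = v then 1 else 0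

/-- The simple reflection at a vertex. -/
def sref (Q : FinQuiver) (v : Q.V) : (Q.V → ℤ) → (Q.V → ℤ) := reflV Q (simRoot Q v)

/-- An enumeration of the vertices is compatible with the arrows of `Q` if sources
of arrows come before targets. -/
def OrdCompatible (Q : FinQuiver) (ord : Fin (Fintype.card Q.V) ≃ Q.V) : Prop :=
  ∀ (x y : Q.V), (x ⟶ y) → ord.symm x < ord.symm y

/-- The Coxeter element `cox(Q)`: the product of the simple reflections from left to
right in an order compatible with the arrows of `Q`. -/
def coxeter (Q : FinQuiver) (ord : Fin (Fintype.card Q.V) ≃ Q.V) :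
    (Q.V → ℤ) → (Q.V → ℤ) :=
  comps Q fun i => sref Q (ord i)

/-- The product of the simple reflections indexed by a word (a list of vertices). -/
def wordProd (Q : FinQuiver) (l : List Q.V) : (Q.V → ℤ) → (Q.V → ℤ) :=
  (l.map (sref Q)).foldr (· ∘ ·) id

/-- Membership in the Coxeter group `W` (realized faithfully on the root lattice). -/
def InW (Q : FinQuiver) (w : (Q.V → ℤ) → (Q.V → ℤ)) : Prop :=
  ∃ l : List Q.V, w = wordProd Q l

/-- The reflections of `W`: the conjugates of the simple reflections. -/
def IsRefl (Q : FinQuiver) (t : (Q.V → ℤ) → (Q.V → ℤ)) : Prop :=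
  ∃ (l : List Q.V) (i : Q.V), t = wordProd Q l ∘ sref Q i ∘ wordProd Q l.reverse

/-- The absolute length: the least length of an expression as a product of reflections. -/
def ellT (Q : FinQuiver) (w : (Q.V → ℤ) → (Q.V → ℤ)) : ℕ :=
  sInf { m | ∃ f : Fin m → ((Q.V → ℤ) → (Q.V → ℤ)), (∀ i, IsRefl Q (f i)) ∧ w = comps Q f }

/-- The absolute order on `W`. -/
def absLe (Q : FinQuiver) : ((Q.V → ℤ) → (Q.V → ℤ)) → ((Q.V → ℤ) → (Q.V → ℤ)) → Prop :=
  Relation.ReflTransGen fun u v => ∃ t, IsRefl Q t ∧ v = u ∘ t ∧ ellT Q v = ellT Q u + 1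

/-- The noncrossing partitions `NC_Q`: the interval `[e, cox(Q)]` in absolute order. -/
def NCSet (Q : FinQuiver) (ord : Fin (Fintype.card Q.V) ≃ Q.V) :
    Set ((Q.V → ℤ) → (Q.V → ℤ)) :=
  { w | InW Q w ∧ absLe Q w (coxeter Q ord) }

/-- `Q` is of finite (Dynkin) type: the symmetrized Euler form is positive definite. -/
def FiniteType (Q : FinQuiver) : Prop :=
  ∀ α : Q.V → ℚ, α ≠ 0 → 0 < symEuler Q α α

/-- `Q` is of affine (extended Dynkin) type: the symmetrized Euler form is positive
semidefinite with nontrivial radical. -/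
def AffineType (Q : FinQuiver) : Prop :=
  (∀ α : Q.V → ℚ, 0 ≤ symEuler Q α α) ∧ ∃ α : Q.V → ℚ, α ≠ 0 ∧ symEuler Q α α = 0

end Comb

section ClusterCategory

variable {k : Type} [Field k] {Q : FinQuiver}

/-- An object of the cluster category `CC_Q = D^b(rep Q)/τ⁻¹[1]`, presented through a
fundamental domain: a representation of `Q` (the summands lying in `rep Q`) together
with a set of vertices recording the shifted projective summands `P_i[1]`. -/
structure CCObj (k : Type) [Field k] (Q : FinQuiver) : Type 1 where
  r : RepC k Q
  sh : Set Q.V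

/-- `P` is (a representative of) the indecomposable projective representation at the
vertex `v`: it is indecomposable projective and its simple top is concentrated
at `v`. -/
def IsProjAt (P : RepC k Q) (v : Q.V) : Prop :=
  FinDim P ∧ Indec P ∧ Projective P ∧
    ∀ S : RepC k Q, FinDim S → Simple S →
      ((∃ f : P ⟶ S, f ≠ 0) ↔ ¬ IsZero (S.obj ((Paths.of Q.V).obj v)))

/-- Vanishing of `Ext¹` in the cluster category, described on the fundamental domain:
for `X, Y ∈ rep Q`, `Ext¹_CC(X,Y) = 0` iff `Ext¹(X,Y) = 0 = Ext¹(Y,X)`;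
`Ext¹_CC(X, P_i[1]) = 0` iff `Hom(P_i, X) = 0`; and shifted projectives have no
self-extensions.  (`P` is the family of indecomposable projectives.) -/
def CCExt1Zero (P : Q.V → RepC k Q) (X Y : CCObj k Q) : Prop :=
  Ext1Zero X.r Y.r ∧ Ext1Zero Y.r X.r ∧
    (∀ i ∈ X.sh, HomZero (P i) Y.r) ∧ ∀ j ∈ Y.sh, HomZero (P j) X.r

/-- `X` is a cluster tilting object of `CC_Q`: it has no self-extensions in `CC_Q` and
every indecomposable of `CC_Q` (an indecomposable representation, or a shifted
projective `P_j[1]`) having no extensions with `X` is a direct summand of `X`. -/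
def IsClusterTilting (P : Q.V → RepC k Q) (X : CCObj k Q) : Prop :=
  CCExt1Zero P X X ∧
  (∀ U : RepC k Q, FinDim U → Indec U → Ext1Zero X.r U → Ext1Zero U X.r →
      (∀ i ∈ X.sh, HomZero (P i) U) → IsSummand U X.r) ∧
  (∀ j : Q.V, HomZero (P j) X.r → j ∈ X.sh)

end ClusterCategory

section Statement12

variable {k : Type} [Field k] {Q : FinQuiver}

/-- An indecomposable object of the cluster category: either an indecomposable
representation of `Q`, or a shifted projective `P_i[1]`. -/
def CCIndec (X : CCObj k Q) : Prop :=
  (Indec X.r ∧ X.sh = ∅) ∨ (IsZero X.r ∧ ∃ i : Q.V, X.sh = {i})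

/-- Direct sum in the cluster category (on the fundamental domain). -/
noncomputable def CCSum (X Y : CCObj k Q) : CCObj k Q := ⟨X.r ⊞ Y.r, X.sh ∪ Y.sh⟩

/-- Isomorphism of objects of the cluster category. -/
def CCIso (X Y : CCObj k Q) : Prop := Nonempty (X.r ≅ Y.r) ∧ X.sh = Y.sh

/-- `X` has exactly `m` pairwise nonisomorphic indecomposable direct summands. -/
def CCNumIndecSummands (X : CCObj k Q) (m : ℕ) : Prop :=
  ∃ (r : ℕ) (f : Fin r → RepC k Q),
    (∀ i, Indec (f i) ∧ IsSummand (f i) X.r) ∧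
    (∀ i j, Nonempty (f i ≅ f j) → i = j) ∧
    (∀ M : RepC k Q, Indec M → IsSummand M X.r → ∃ i, Nonempty (M ≅ f i)) ∧
    m = r + X.sh.ncard

/-- An almost tilting object of `CC_Q`: partial tilting with `n − 1` pairwise
nonisomorphic indecomposable direct summands, where `n` is the number of vertices. -/
def IsAlmostTilting (P : Q.V → RepC k Q) (X : CCObj k Q) : Prop :=
  CCExt1Zero P X X ∧ CCNumIndecSummands X (Fintype.card Q.V - 1)

/-- A complement of an almost tilting object `S`: an indecomposable `M` of `CC_Q`
such that `S ⊕ M` is cluster tilting. -/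
def IsComplement (P : Q.V → RepC k Q) (S M : CCObj k Q) : Prop :=
  CCIndec M ∧ IsClusterTilting P (CCSum S M)

/-- `M` lies in `rep Q` and is split projective in `Gen(M ⊕ S)`, the subcategory of
`rep Q` generated by the summands of `M ⊕ S` lying in `rep Q`. -/
def CCSplitProjGen (M S : CCObj k Q) : Prop :=
  M.sh = ∅ ∧ SplitProjIn (gen ({(CCSum M S).r} : Set (RepC k Q))) M.r

end Statement12

section Concrete

variable {k : Type} [Field k] {Q : FinQuiver}

/-- value at a vertex -/
abbrev ob (A : RepC k Q) (v : Q.V) : ModuleCat.{0} k := A.obj ((Paths.of Q.V).obj v)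

/-- action of an arrow -/
def ar (A : RepC k Q) {v w : Q.V} (a : v ⟶ w) : ob A v →ₗ[k] ob A w :=
  (A.map ((Paths.of Q.V).map a)).hom

/-- component of a morphism -/
def ap {A B : RepC k Q} (f : A ⟶ B) (v : Q.V) : ob A v →ₗ[k] ob B v :=
  (f.app ((Paths.of Q.V).obj v)).hom

/-- all arrows -/
abbrev Arr (Q : FinQuiver) := Σ x : Q.V, Σ y : Q.V, x ⟶ y

abbrev C0 (A B : RepC k Q) := ∀ v : Q.V, ob A v →ₗ[k] ob B v
abbrev C1 (A B : RepC k Q) := ∀ a : Arr Q, ob A a.1 →ₗ[k] ob B a.2.1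

def DD (A B : RepC k Q) : C0 A B →ₗ[k] C1 A B where
  toFun u := fun a => ar B a.2.2 ∘ₗ u a.1 - u a.2.1 ∘ₗ ar A a.2.2
  map_add' u w := by
    funext a
    simp only [Pi.add_apply, LinearMap.comp_add, LinearMap.add_comp]
    abel
  map_smul' c u := by
    funext a
    simp only [Pi.smul_apply, LinearMap.comp_smul, LinearMap.smul_comp, RingHom.id_apply, smul_sub]

theorem DD_apply {A B : RepC k Q} (u : C0 A B) (a : Arr Q) :
    DD A B u a = ar B a.2.2 ∘ₗ u a.1 - u a.2.1 ∘ₗ ar A a.2.2 := rfl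

@[simp] theorem ap_comp {A B C : RepC k Q} (f : A ⟶ B) (g : B ⟶ C) (v : Q.V) :
    ap (f ≫ g) v = ap g v ∘ₗ ap f v := rfl

@[simp] theorem ap_id (A : RepC k Q) (v : Q.V) : ap (𝟙 A) v = LinearMap.id := rfl
@[simp] theorem ap_zero (A B : RepC k Q) (v : Q.V) : ap (0 : A ⟶ B) v = 0 := rfl
@[simp] theorem ap_add {A B : RepC k Q} (f g : A ⟶ B) (v : Q.V) :
    ap (f + g) v = ap f v + ap g v := rfl
@[simp] theorem ap_smul {A B : RepC k Q} (c : k) (f : A ⟶ B) (v : Q.V) :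
    ap (c • f) v = c • ap f v := rfl

theorem ap_nat {A B : RepC k Q} (f : A ⟶ B) {v w : Q.V} (a : v ⟶ w) :
    ar B a ∘ₗ ap f v = ap f w ∘ₗ ar A a := by
  have := f.naturality ((Paths.of Q.V).map a)
  have h2 := congrArg ModuleCat.Hom.hom this
  exact h2.symm

theorem hom_ext' {A B : RepC k Q} {f g : A ⟶ B} (h : ∀ v, ap f v = ap g v) : f = g := by
  apply NatTrans.ext
  funext v
  exact ModuleCat.hom_ext (h v)

theorem natOfArrows {A B : RepC k Q} (φ : ∀ x, A.obj x ⟶ B.obj x)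
    (h : ∀ {v w : Q.V} (a : v ⟶ w), A.map ((Paths.of Q.V).map a) ≫ φ _ =
      φ _ ≫ B.map ((Paths.of Q.V).map a)) {x y : Paths Q.V} (f : x ⟶ y) :
    A.map f ≫ φ y = φ x ≫ B.map f := by
  refine Paths.induction (fun {x y} f => A.map f ≫ φ y = φ x ≫ B.map f) ?_ ?_ f
  · intro v
    rw [A.map_id, B.map_id, Category.id_comp, Category.comp_id]
  · intro a b c p q hp
    rw [A.map_comp, B.map_comp, Category.assoc, ← Category.assoc _ (B.map p), ← hp,
      Category.assoc, h q]

/-- build a morphism from vertex components -/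
def mkHom {A B : RepC k Q} (u : C0 A B)
    (h : ∀ {v w : Q.V} (a : v ⟶ w), ar B a ∘ₗ u v = u w ∘ₗ ar A a) : A ⟶ B where
  app v := ModuleCat.ofHom (u v)
  naturality {x y} f := by
    refine natOfArrows (A := A) (B := B) (fun x => ModuleCat.ofHom (u x)) ?_ f
    intro v w a
    apply ModuleCat.hom_ext
    exact (h a).symm

@[simp] theorem ap_mkHom {A B : RepC k Q} (u : C0 A B) (h) (v : Q.V) :
    ap (mkHom u h) v = u v := rfl

/-- build a representation -/
def mkRep (X : Q.V → ModuleCat.{0} k) (m : ∀ {v w : Q.V}, (v ⟶ w) → (X v →ₗ[k] X w)) :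
    RepC k Q :=
  Paths.lift { obj := X, map := fun a => ModuleCat.ofHom (m a) }

theorem ob_mkRep (X : Q.V → ModuleCat.{0} k) (m : ∀ {v w : Q.V}, (v ⟶ w) → (X v →ₗ[k] X w))
    (v : Q.V) : ob (mkRep X m) v = X v := rfl

theorem ar_mkRep (X : Q.V → ModuleCat.{0} k) (m : ∀ {v w : Q.V}, (v ⟶ w) → (X v →ₗ[k] X w))
    {v w : Q.V} (a : v ⟶ w) : ar (mkRep X m) a = m a := by
  have : (mkRep X m).map ((Paths.of Q.V).map a) = ModuleCat.ofHom (m a) := by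
    exact Paths.lift_toPath _ a
  exact congrArg ModuleCat.Hom.hom this

theorem mono_iff_inj {A B : RepC k Q} (f : A ⟶ B) :
    Mono f ↔ ∀ v, Function.Injective (ap f v) := by
  rw [NatTrans.mono_iff_mono_app]
  exact forall_congr' fun v => ModuleCat.mono_iff_injective _

theorem epi_iff_surj {A B : RepC k Q} (f : A ⟶ B) :
    Epi f ↔ ∀ v, Function.Surjective (ap f v) := by
  rw [NatTrans.epi_iff_epi_app]
  exact forall_congr' fun v => ModuleCat.epi_iff_surjective _

theorem isZero_iff_subs (A : RepC k Q) : IsZero A ↔ ∀ v, Subsingleton (ob A v) := by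
  rw [Functor.isZero_iff]
  exact forall_congr' fun v => ModuleCat.isZero_iff_subsingleton

theorem ses_iff {A B C : RepC k Q} (i : A ⟶ B) (p : B ⟶ C) (w : i ≫ p = 0) :
    (ShortComplex.mk i p w).ShortExact ↔ ∀ v, Function.Injective (ap i v) ∧
      Function.Surjective (ap p v) ∧ Function.Exact (ap i v) (ap p v) := by
  constructor
  · intro h v
    have h2 := h.map_of_exact ((evaluation _ _).obj ((Paths.of Q.V).obj v))
    exact ⟨h2.moduleCat_injective_f, h2.moduleCat_surjective_g,
      (ShortComplex.ShortExact.moduleCat_exact_iff_function_exact _).1 h2.exact⟩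
  · intro h
    have hm : Mono i := (mono_iff_inj i).2 fun v => (h v).1
    have he : Epi p := (epi_iff_surj p).2 fun v => (h v).2.1
    refine ShortComplex.ShortExact.mk' ?_ hm he
    rw [ShortComplex.exact_iff_epi_kernel_lift]
    rw [epi_iff_surj]
    intro v y
    have hk : ap p v (ap (kernel.ι p) v y) = 0 := by
      have := congrArg (fun f => ap f v y) (kernel.condition p)
      exact this
    obtain ⟨a, ha⟩ := ((h v).2.2 _).1 hk
    refine ⟨a, ?_⟩
    apply (mono_iff_inj (kernel.ι p)).1 inferInstance v
    rw [← ha]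
    have := congrArg (fun f => ap f v a) (kernel.lift_ι p i w)
    exact this

end Concrete

section ExtDS

variable {k : Type} [Field k] {Q : FinQuiver}

/-- surjectivity of the standard differential -/
def DS (A B : RepC k Q) : Prop := Function.Surjective (DD A B)

theorem lin_lift {X Y Z : Type} [AddCommGroup X] [AddCommGroup Y] [AddCommGroup Z]
    [Module k X] [Module k Y] [Module k Z] {p : Y →ₗ[k] Z} (hp : Function.Surjective p)
    (g : X →ₗ[k] Z) : ∃ h : X →ₗ[k] Y, p ∘ₗ h = g := by
  obtain ⟨s, hs⟩ := p.exists_rightInverse_of_surjective (LinearMap.range_eq_top.2 hp)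
  exact ⟨s ∘ₗ g, by rw [← LinearMap.comp_assoc, hs, LinearMap.id_comp]⟩

theorem lin_ext {X Y Z : Type} [AddCommGroup X] [AddCommGroup Y] [AddCommGroup Z]
    [Module k X] [Module k Y] [Module k Z] {i : X →ₗ[k] Y} (hi : Function.Injective i)
    (g : X →ₗ[k] Z) : ∃ h : Y →ₗ[k] Z, h ∘ₗ i = g := by
  obtain ⟨s, hs⟩ := i.exists_leftInverse_of_injective (LinearMap.ker_eq_bot.2 hi)
  exact ⟨g ∘ₗ s, by rw [LinearMap.comp_assoc, hs, LinearMap.comp_id]⟩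

theorem lin_ker {X A B C : Type} [AddCommGroup X] [AddCommGroup A] [AddCommGroup B]
    [AddCommGroup C] [Module k X] [Module k A] [Module k B] [Module k C]
    {i : A →ₗ[k] B} {p : B →ₗ[k] C} (hi : Function.Injective i) (hex : Function.Exact i p)
    (g : X →ₗ[k] B) (hg : p ∘ₗ g = 0) : ∃ h : X →ₗ[k] A, i ∘ₗ h = g := by
  obtain ⟨s, hs⟩ := i.exists_leftInverse_of_injective (LinearMap.ker_eq_bot.2 hi)
  refine ⟨s ∘ₗ g, ?_⟩
  ext x
  obtain ⟨a, ha⟩ := (hex (g x)).1 (LinearMap.congr_fun hg x)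
  have : s (i a) = a := LinearMap.congr_fun hs a
  simp [← ha, this]

theorem lin_coker {X A B C : Type} [AddCommGroup X] [AddCommGroup A] [AddCommGroup B]
    [AddCommGroup C] [Module k X] [Module k A] [Module k B] [Module k C]
    {i : A →ₗ[k] B} {p : B →ₗ[k] C} (hp : Function.Surjective p) (hex : Function.Exact i p)
    (g : B →ₗ[k] X) (hg : g ∘ₗ i = 0) : ∃ h : C →ₗ[k] X, h ∘ₗ p = g := by
  obtain ⟨s, hs⟩ := p.exists_rightInverse_of_surjective (LinearMap.range_eq_top.2 hp)
  refine ⟨g ∘ₗ s, ?_⟩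
  ext x
  have h1 : p (x - s (p x)) = 0 := by
    have : p (s (p x)) = p x := LinearMap.congr_fun hs (p x)
    simp [this]
  obtain ⟨a, ha⟩ := (hex _).1 h1
  have : g (i a) = 0 := LinearMap.congr_fun hg a
  rw [ha, map_sub, sub_eq_zero] at this
  simp [this]

theorem retr_of_sec {A B C : RepC k Q} {i : A ⟶ B} {p : B ⟶ C} {w : i ≫ p = 0}
    (h : (ShortComplex.mk i p w).ShortExact) (s : C ⟶ B) (hs : s ≫ p = 𝟙 C) :
    ∃ r : B ⟶ A, i ≫ r = 𝟙 A :=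
  ⟨_, (ShortComplex.Splitting.ofExactOfSection _ h.exact s hs h.mono_f).f_r⟩

theorem sec_of_retr {A B C : RepC k Q} {i : A ⟶ B} {p : B ⟶ C} {w : i ≫ p = 0}
    (h : (ShortComplex.mk i p w).ShortExact) (r : B ⟶ A) (hr : i ≫ r = 𝟙 A) :
    ∃ s : C ⟶ B, s ≫ p = 𝟙 C :=
  ⟨_, (ShortComplex.Splitting.ofExactOfRetraction _ h.exact r hr h.epi_g).s_g⟩

theorem ext_of_DS {A B : RepC k Q} (h : DS A B) : Ext1Zero A B := by
  intro E i p w hs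
  have hv := (ses_iff i p w).1 hs
  choose σ hσ using fun v => lin_lift (hv v).2.1 (LinearMap.id (R := k) (M := ob A v))
  have hc : ∀ a : Arr Q, ∃ c : ob A a.1 →ₗ[k] ob B a.2.1,
      ap i a.2.1 ∘ₗ c = ar E a.2.2 ∘ₗ σ a.1 - σ a.2.1 ∘ₗ ar A a.2.2 := by
    intro a
    refine lin_ker (hv _).1 (hv _).2.2 _ ?_
    rw [LinearMap.comp_sub, ← LinearMap.comp_assoc, ← ap_nat, LinearMap.comp_assoc, hσ,
      ← LinearMap.comp_assoc, hσ, LinearMap.comp_id, LinearMap.id_comp, sub_self]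
  choose c hc using hc
  obtain ⟨ρ, hρ⟩ := h c
  refine retr_of_sec hs (mkHom (fun v => σ v - ap i v ∘ₗ ρ v) ?_) ?_
  · intro v w a
    have h1 := hc ⟨v, w, a⟩
    rw [← hρ, DD_apply] at h1
    simp only [LinearMap.comp_sub, LinearMap.sub_comp] at h1 ⊢
    rw [← LinearMap.comp_assoc _ _ (ar E a), ap_nat]
    rw [LinearMap.comp_assoc, LinearMap.comp_assoc]
    rw [sub_eq_sub_iff_add_eq_add] at h1 ⊢
    rw [add_comm (σ w ∘ₗ _)]
    exact h1.symm
  · apply hom_ext'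
    intro v
    have hz : ap p v ∘ₗ ap i v = 0 := by rw [← ap_comp, w, ap_zero]
    rw [ap_comp, ap_mkHom, LinearMap.comp_sub, hσ, ← LinearMap.comp_assoc, hz,
      LinearMap.zero_comp, sub_zero, ap_id]

/-- twisted extension -/
def tw {A B : RepC k Q} (c : C1 A B) : RepC k Q :=
  mkRep (fun v => ModuleCat.of k (ob B v × ob A v)) fun {v w} a =>
    ((ar B a ∘ₗ LinearMap.fst k _ _ + c ⟨v, w, a⟩ ∘ₗ LinearMap.snd k _ _).prod
      (ar A a ∘ₗ LinearMap.snd k _ _) : (ob B v × ob A v) →ₗ[k] (ob B w × ob A w))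

theorem ar_tw {A B : RepC k Q} (c : C1 A B) {v w : Q.V} (a : v ⟶ w) (x : ob B v × ob A v) :
    (show ob B w × ob A w from ar (tw c) a x) =
      (ar B a x.1 + c ⟨v, w, a⟩ x.2, ar A a x.2) := by
  unfold tw
  rw [ar_mkRep]
  rfl

theorem DS_of_ext {A B : RepC k Q} (h : Ext1Zero A B) : DS A B := by
  intro c
  let i : B ⟶ tw c := mkHom (fun v => (LinearMap.inl k (ob B v) (ob A v))) (by
    intro v w a
    refine LinearMap.ext fun x => ?_
    refine (ar_tw c a (x, 0)).trans ?_
    exact Prod.ext (by simp; rfl) (by simp; rfl))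
  let p : tw c ⟶ A := mkHom (fun v => (LinearMap.snd k (ob B v) (ob A v))) (by
    intro v w a
    refine LinearMap.ext fun x => ?_
    exact (congrArg Prod.snd (ar_tw c a x)).symm)
  have w : i ≫ p = 0 := by
    apply hom_ext'
    intro v
    refine LinearMap.ext fun x => rfl
  obtain ⟨r, hr⟩ := h (tw c) i p w ((ses_iff i p w).2 fun v =>
    ⟨LinearMap.inl_injective (R := k) (M := ob B v) (M₂ := ob A v),
      LinearMap.snd_surjective (R := k) (M := ob B v) (M₂ := ob A v), fun x => by
      constructor
      · intro hx
        refine ⟨x.1, Prod.ext rfl ?_⟩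
        exact hx.symm
      · rintro ⟨y, rfl⟩
        rfl⟩)
  let R : ∀ v, (ob B v × ob A v) →ₗ[k] ob B v := fun v => ap r v
  have hR : ∀ v (b : ob B v), R v (b, 0) = b := fun v b =>
    LinearMap.congr_fun (congrArg (fun f => ap f v) hr) b
  refine ⟨fun v => R v ∘ₗ LinearMap.inr k _ _, ?_⟩
  funext ⟨v, w, a⟩
  refine LinearMap.ext fun x => ?_
  have hn := LinearMap.congr_fun (ap_nat r a) ((0, x) : ob B v × ob A v)
  have hn2 : ar B a (R v (0, x)) = R w (ar B a 0 + c ⟨v, w, a⟩ x, ar A a x) := by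
    refine hn.trans ?_
    exact congrArg (R w) (ar_tw c a (0, x))
  rw [DD_apply]
  simp only [LinearMap.sub_apply, LinearMap.comp_apply, LinearMap.inr_apply]
  rw [hn2, map_zero, zero_add]
  have : ((c ⟨v, w, a⟩ x, ar A a x) : ob B w × ob A w) = (c ⟨v, w, a⟩ x, 0) + (0, ar A a x) := by
    simp
  rw [this, map_add, hR, add_sub_cancel_right]

theorem ext_iff_DS {A B : RepC k Q} : Ext1Zero A B ↔ DS A B := ⟨DS_of_ext, ext_of_DS⟩

theorem DD_post {A B C : RepC k Q} (u : C0 A B) (f : B ⟶ C) (a : Arr Q) :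
    DD A C (fun v => ap f v ∘ₗ u v) a = ap f a.2.1 ∘ₗ DD A B u a := by
  rw [DD_apply, DD_apply, LinearMap.comp_sub, ← LinearMap.comp_assoc, ap_nat]
  simp only [LinearMap.comp_assoc]

theorem DD_pre {A B C : RepC k Q} (f : A ⟶ B) (u : C0 B C) (a : Arr Q) :
    DD A C (fun v => u v ∘ₗ ap f v) a = DD B C u a ∘ₗ ap f a.1 := by
  rw [DD_apply, DD_apply, LinearMap.sub_comp, LinearMap.comp_assoc, LinearMap.comp_assoc,
    LinearMap.comp_assoc, ap_nat]

/-- right exactness -/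
theorem ext_quot {A B C : RepC k Q} (h : Ext1Zero A B) (p : B ⟶ C) (hp : Epi p) :
    Ext1Zero A C := by
  rw [ext_iff_DS] at *
  intro c
  choose c' hc' using fun a : Arr Q => lin_lift ((epi_iff_surj p).1 hp a.2.1) (c a)
  obtain ⟨u, hu⟩ := h c'
  refine ⟨fun v => ap p v ∘ₗ u v, ?_⟩
  funext a
  rw [DD_post, hu, hc']

theorem ext_sub {A B C : RepC k Q} (h : Ext1Zero B C) (i : A ⟶ B) (hi : Mono i) :
    Ext1Zero A C := by
  rw [ext_iff_DS] at *
  intro c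
  choose c' hc' using fun a : Arr Q => lin_ext ((mono_iff_inj i).1 hi a.1) (c a)
  obtain ⟨u, hu⟩ := h c'
  refine ⟨fun v => u v ∘ₗ ap i v, ?_⟩
  funext a
  rw [DD_pre, hu, hc']

theorem ext_ext_right {X A B C : RepC k Q} {i : A ⟶ B} {p : B ⟶ C} {w : i ≫ p = 0}
    (h : (ShortComplex.mk i p w).ShortExact) (hA : Ext1Zero X A) (hC : Ext1Zero X C) :
    Ext1Zero X B := by
  rw [ext_iff_DS] at *
  have hv := (ses_iff i p w).1 h
  intro c
  obtain ⟨u, hu⟩ := hC fun a => ap p _ ∘ₗ c a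
  choose u' hu' using fun v => lin_lift (hv v).2.1 (u v)
  have h2 : ∀ a : Arr Q, ap p a.2.1 ∘ₗ (c a - DD X B u' a) = 0 := by
    intro a
    rw [LinearMap.comp_sub, ← DD_post]
    simp only [hu']
    rw [hu, sub_self]
  choose d hd using fun a : Arr Q => lin_ker (hv _).1 (hv _).2.2 _ (h2 a)
  obtain ⟨t, ht⟩ := hA d
  refine ⟨u' + fun v => ap i v ∘ₗ t v, ?_⟩
  funext a
  rw [map_add, Pi.add_apply, DD_post, ht, hd]
  abel

theorem ext_ext_left {X A B C : RepC k Q} {i : A ⟶ B} {p : B ⟶ C} {w : i ≫ p = 0}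
    (h : (ShortComplex.mk i p w).ShortExact) (hA : Ext1Zero A X) (hC : Ext1Zero C X) :
    Ext1Zero B X := by
  rw [ext_iff_DS] at *
  have hv := (ses_iff i p w).1 h
  intro c
  obtain ⟨u, hu⟩ := hA fun a => c a ∘ₗ ap i _
  choose u' hu' using fun v => lin_ext (hv v).1 (u v)
  have h2 : ∀ a : Arr Q, (c a - DD B X u' a) ∘ₗ ap i a.1 = 0 := by
    intro a
    rw [LinearMap.sub_comp, ← DD_pre]
    simp only [hu']
    rw [hu, sub_self]
  choose d hd using fun a : Arr Q => lin_coker (hv _).2.1 (hv _).2.2 _ (h2 a)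
  obtain ⟨t, ht⟩ := hC d
  refine ⟨u' + fun v => t v ∘ₗ ap p v, ?_⟩
  funext a
  rw [map_add, Pi.add_apply, DD_pre, ht, hd]
  abel

/-- lifting along an epimorphism whose kernel has no Ext -/
theorem lift_of_ext {X A B C : RepC k Q} {i : A ⟶ B} {p : B ⟶ C} {w : i ≫ p = 0}
    (h : (ShortComplex.mk i p w).ShortExact) (hA : Ext1Zero X A) (g : X ⟶ C) :
    ∃ g' : X ⟶ B, g' ≫ p = g := by
  rw [ext_iff_DS] at *
  have hv := (ses_iff i p w).1 h
  choose u hu using fun v => lin_lift (hv v).2.1 (ap g v)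
  have h2 : ∀ a : Arr Q, ap p a.2.1 ∘ₗ (DD X B u a) = 0 := by
    intro a
    rw [← DD_post]
    simp only [hu]
    rw [DD_apply, ap_nat, sub_self]
  choose d hd using fun a : Arr Q => lin_ker (hv _).1 (hv _).2.2 _ (h2 a)
  obtain ⟨t, ht⟩ := hA d
  have h0 : DD X B (u - fun v => ap i v ∘ₗ t v) = 0 := by
    funext a
    rw [map_sub, Pi.sub_apply, DD_post, ht, hd, sub_self]
    rfl
  refine ⟨mkHom (u - fun v => ap i v ∘ₗ t v) ?_, ?_⟩
  · intro v w a
    exact sub_eq_zero.1 (congrFun h0 ⟨v, w, a⟩)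
  · apply hom_ext'
    intro v
    have hz : ap p v ∘ₗ ap i v = 0 := by rw [← ap_comp, w, ap_zero]
    rw [ap_comp, ap_mkHom, Pi.sub_apply, LinearMap.comp_sub, hu, ← LinearMap.comp_assoc, hz,
      LinearMap.zero_comp, sub_zero]

/-- extension along a monomorphism whose cokernel has no Ext -/
theorem extend_of_ext {X A B C : RepC k Q} {i : A ⟶ B} {p : B ⟶ C} {w : i ≫ p = 0}
    (h : (ShortComplex.mk i p w).ShortExact) (hC : Ext1Zero C X) (g : A ⟶ X) :
    ∃ g' : B ⟶ X, i ≫ g' = g := by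
  rw [ext_iff_DS] at *
  have hv := (ses_iff i p w).1 h
  choose u hu using fun v => lin_ext (hv v).1 (ap g v)
  have h2 : ∀ a : Arr Q, (DD B X u a) ∘ₗ ap i a.1 = 0 := by
    intro a
    rw [← DD_pre]
    simp only [hu]
    rw [DD_apply, ap_nat, sub_self]
  choose d hd using fun a : Arr Q => lin_coker (hv _).2.1 (hv _).2.2 _ (h2 a)
  obtain ⟨t, ht⟩ := hC d
  have h0 : DD B X (u - fun v => t v ∘ₗ ap p v) = 0 := by
    funext a
    rw [map_sub, Pi.sub_apply, DD_pre, ht, hd, sub_self]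
    rfl
  refine ⟨mkHom (u - fun v => t v ∘ₗ ap p v) ?_, ?_⟩
  · intro v w a
    exact sub_eq_zero.1 (congrFun h0 ⟨v, w, a⟩)
  · apply hom_ext'
    intro v
    have hz : ap p v ∘ₗ ap i v = 0 := by rw [← ap_comp, w, ap_zero]
    rw [ap_comp, ap_mkHom, Pi.sub_apply, LinearMap.sub_comp, hu, LinearMap.comp_assoc, hz,
      LinearMap.comp_zero, sub_zero]

/-- two-term decomposition of the identity, target variable -/
theorem ext_add_right {ι : Type} (s : Finset ι) {A B : RepC k Q} (C : ι → RepC k Q)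
    (π : ∀ i, B ⟶ C i) (j : ∀ i, C i ⟶ B) (h1 : ∑ i ∈ s, π i ≫ j i = 𝟙 B)
    (h : ∀ i ∈ s, Ext1Zero A (C i)) : Ext1Zero A B := by
  rw [ext_iff_DS]
  have key : ∀ g : B ⟶ B, g = ∑ i ∈ s, π i ≫ j i → ∀ c : C1 A B,
      (fun a => ap g a.2.1 ∘ₗ c a : C1 A B) ∈ LinearMap.range (DD A B) := by
    rintro g rfl c
    have : (fun a => ap (∑ i ∈ s, π i ≫ j i) a.2.1 ∘ₗ c a : C1 A B) =
        ∑ i ∈ s, (fun a => ap (π i ≫ j i) a.2.1 ∘ₗ c a : C1 A B) := by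
      clear h1 h
      induction s using Finset.cons_induction with
      | empty => simp; rfl
      | cons x s hx ih =>
        rw [Finset.sum_cons, Finset.sum_cons, ← ih]
        funext a
        simp [LinearMap.add_comp]
    rw [this]
    refine Submodule.sum_mem _ fun i hi => ?_
    obtain ⟨u, hu⟩ := (ext_iff_DS.1 (h i hi)) (fun a => ap (π i) a.2.1 ∘ₗ c a)
    refine ⟨fun v => ap (j i) v ∘ₗ u v, ?_⟩
    funext a
    rw [DD_post, hu, ap_comp, LinearMap.comp_assoc]
  intro c
  have := key (𝟙 B) h1.symm c
  simpa using this

theorem ext_add_left {ι : Type} (s : Finset ι) {A B : RepC k Q} (C : ι → RepC k Q)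
    (π : ∀ i, B ⟶ C i) (j : ∀ i, C i ⟶ B) (h1 : ∑ i ∈ s, π i ≫ j i = 𝟙 B)
    (h : ∀ i ∈ s, Ext1Zero (C i) A) : Ext1Zero B A := by
  rw [ext_iff_DS]
  have key : ∀ g : B ⟶ B, g = ∑ i ∈ s, π i ≫ j i → ∀ c : C1 B A,
      (fun a => c a ∘ₗ ap g a.1 : C1 B A) ∈ LinearMap.range (DD B A) := by
    rintro g rfl c
    have : (fun a => c a ∘ₗ ap (∑ i ∈ s, π i ≫ j i) a.1 : C1 B A) =
        ∑ i ∈ s, (fun a => c a ∘ₗ ap (π i ≫ j i) a.1 : C1 B A) := by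
      clear h1 h
      induction s using Finset.cons_induction with
      | empty => simp; rfl
      | cons x s hx ih =>
        rw [Finset.sum_cons, Finset.sum_cons, ← ih]
        funext a
        simp [LinearMap.comp_add]
    rw [this]
    refine Submodule.sum_mem _ fun i hi => ?_
    obtain ⟨u, hu⟩ := (ext_iff_DS.1 (h i hi)) (fun a => c a ∘ₗ ap (j i) a.1)
    refine ⟨fun v => u v ∘ₗ ap (π i) v, ?_⟩
    funext a
    rw [DD_pre, hu, ap_comp, LinearMap.comp_assoc]
  intro c
  have := key (𝟙 B) h1.symm c
  simpa using this

end ExtDS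

section Dims

variable {k : Type} [Field k] {Q : FinQuiver}

theorem fd_of_mono {A B : RepC k Q} (i : A ⟶ B) (hi : Mono i) (hB : FinDim B) : FinDim A := by
  intro v
  have := hB v
  exact FiniteDimensional.of_injective (ap i v) ((mono_iff_inj i).1 hi v)

theorem fd_of_epi {A B : RepC k Q} (p : A ⟶ B) (hp : Epi p) (hA : FinDim A) : FinDim B := by
  intro v
  have := hA v
  exact Module.Finite.of_surjective (ap p v) ((epi_iff_surj p).1 hp v)

theorem fd_of_ses {A B C : RepC k Q} {i : A ⟶ B} {p : B ⟶ C} {w : i ≫ p = 0}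
    (h : (ShortComplex.mk i p w).ShortExact) (hA : FinDim A) (hC : FinDim C) : FinDim B := by
  intro v
  have hv := (ses_iff i p w).1 h v
  have := hA v
  have := hC v
  exact Module.Finite.of_exact hv.2.2 hv.2.1

theorem dimVec_ses {A B C : RepC k Q} {i : A ⟶ B} {p : B ⟶ C} {w : i ≫ p = 0}
    (h : (ShortComplex.mk i p w).ShortExact) (hB : FinDim B) :
    dimVec B = dimVec A + dimVec C := by
  funext v
  have hv := (ses_iff i p w).1 h v
  have := hB v
  have e1 := LinearMap.finrank_range_add_finrank_ker (ap p v)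
  have e2 := LinearMap.finrank_range_of_inj hv.1
  rw [(LinearMap.exact_iff.1 hv.2.2)] at e1
  rw [LinearMap.range_eq_top.2 hv.2.1, finrank_top, e2] at e1
  simp only [dimVec, Pi.add_apply]
  change (Module.finrank k (ob B v) : ℤ) = Module.finrank k (ob A v) + Module.finrank k (ob C v)
  omega

theorem dimVec_iso {A B : RepC k Q} (e : A ≅ B) : dimVec A = dimVec B := by
  funext v
  have hm : Function.Injective (ap e.hom v) := (mono_iff_inj e.hom).1 inferInstance v
  have he : Function.Surjective (ap e.hom v) := (epi_iff_surj e.hom).1 inferInstance v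
  simp only [dimVec]
  exact congrArg _ (LinearEquiv.ofBijective (ap e.hom v) ⟨hm, he⟩).finrank_eq

theorem dimVec_nonneg (A : RepC k Q) (v : Q.V) : 0 ≤ dimVec A v := by
  simp [dimVec]

theorem dimVec_eq_zero_iff {A : RepC k Q} (hA : FinDim A) (v : Q.V) :
    dimVec A v = 0 ↔ IsZero (ob A v) := by
  have := hA v
  rw [ModuleCat.isZero_iff_subsingleton]
  simp only [dimVec, Nat.cast_eq_zero]
  exact Module.finrank_zero_iff

/-- total dimension -/
def td (A : RepC k Q) : ℕ := ∑ v, Module.finrank k (ob A v)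

theorem td_cast (A : RepC k Q) : (td A : ℤ) = ∑ v, dimVec A v := by
  simp [td, dimVec]

theorem td_ses {A B C : RepC k Q} {i : A ⟶ B} {p : B ⟶ C} {w : i ≫ p = 0}
    (h : (ShortComplex.mk i p w).ShortExact) (hB : FinDim B) : td B = td A + td C := by
  have : (td B : ℤ) = td A + td C := by
    rw [td_cast, td_cast, td_cast, dimVec_ses h hB, ← Finset.sum_add_distrib]
    rfl
  exact_mod_cast this

theorem td_eq_zero_iff {A : RepC k Q} (hA : FinDim A) : td A = 0 ↔ IsZero A := by
  rw [isZero_iff_subs]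
  simp only [td, Finset.sum_eq_zero_iff, Finset.mem_univ, true_imp_iff]
  refine forall_congr' fun v => ?_
  have := hA v
  exact Module.finrank_zero_iff

theorem dimVec_isZero {A : RepC k Q} (h : IsZero A) : dimVec A = 0 := by
  funext v
  have := (isZero_iff_subs A).1 h v
  change (Module.finrank k (ob A v) : ℤ) = 0
  rw [Module.finrank_zero_of_subsingleton]
  rfl

theorem exists_dimVec_pos {A : RepC k Q} (hA : FinDim A) (h : ¬ IsZero A) :
    ∃ v, dimVec A v ≠ 0 := by
  by_contra hc
  push Not at hc
  apply h
  rw [← td_eq_zero_iff hA]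
  have : (td A : ℤ) = 0 := by
    rw [td_cast]
    exact Finset.sum_eq_zero fun v _ => hc v
  exact_mod_cast this

/-- morphisms as the kernel of the differential -/
def homEquiv (A B : RepC k Q) : (A ⟶ B) ≃ₗ[k] LinearMap.ker (DD A B) where
  toFun f := ⟨fun v => ap f v, by
    rw [LinearMap.mem_ker]
    funext a
    rw [DD_apply, ap_nat, sub_self]
    rfl⟩
  map_add' f g := rfl
  map_smul' c f := rfl
  invFun u := mkHom u.1 (fun {v w} a => sub_eq_zero.1 (congrFun (LinearMap.mem_ker.1 u.2) ⟨v, w, a⟩))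
  left_inv f := by
    apply hom_ext'
    intro v
    rfl
  right_inv u := rfl

/-- dimension of the Hom space -/
def hm (A B : RepC k Q) : ℕ := Module.finrank k (A ⟶ B)

theorem finC0 {A B : RepC k Q} (hA : FinDim A) (hB : FinDim B) : Module.Finite k (C0 A B) := by
  have := fun v => hA v
  have := fun v => hB v
  infer_instance

theorem finC1 {A B : RepC k Q} (hA : FinDim A) (hB : FinDim B) : Module.Finite k (C1 A B) := by
  have := fun v => hA v
  have := fun v => hB v
  infer_instance

theorem finHom {A B : RepC k Q} (hA : FinDim A) (hB : FinDim B) : Module.Finite k (A ⟶ B) := by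
  have := finC0 hA hB
  exact Module.Finite.equiv (homEquiv A B).symm

theorem rank_nullity {A B : RepC k Q} (hA : FinDim A) (hB : FinDim B) :
    (hm A B : ℤ) + Module.finrank k (LinearMap.range (DD A B)) = ∑ v, dimVec A v * dimVec B v := by
  have := finC0 hA hB
  have e := LinearMap.finrank_range_add_finrank_ker (DD A B)
  rw [← (homEquiv A B).finrank_eq] at e
  have e2 : (Module.finrank k (C0 A B) : ℤ) = ∑ v, dimVec A v * dimVec B v := by
    have := fun v => hA v
    have := fun v => hB v
    rw [Module.finrank_pi_fintype]
    push_cast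
    refine Finset.sum_congr rfl fun v _ => ?_
    rw [Module.finrank_linearMap]
    push_cast
    rfl
  rw [← e2, ← e]
  push_cast
  rw [add_comm]
  rfl

theorem rankC1 {A B : RepC k Q} (hA : FinDim A) (hB : FinDim B) :
    (Module.finrank k (C1 A B) : ℤ) = ∑ a : Arr Q, dimVec A a.1 * dimVec B a.2.1 := by
  have := fun v => hA v
  have := fun v => hB v
  rw [Module.finrank_pi_fintype]
  push_cast
  refine Finset.sum_congr rfl fun v _ => ?_
  rw [Module.finrank_linearMap]
  push_cast
  rfl

theorem euler_le_hm {A B : RepC k Q} (hA : FinDim A) (hB : FinDim B) :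
    euler Q (dimVec A) (dimVec B) ≤ hm A B := by
  have := finC1 hA hB
  have e1 := rank_nullity hA hB
  have e2 := rankC1 hA hB
  have e3 : Module.finrank k (LinearMap.range (DD A B)) ≤ Module.finrank k (C1 A B) :=
    Submodule.finrank_le _
  unfold euler
  rw [← e1, ← e2]
  omega

theorem ext_iff_hm {A B : RepC k Q} (hA : FinDim A) (hB : FinDim B) :
    Ext1Zero A B ↔ (hm A B : ℤ) = euler Q (dimVec A) (dimVec B) := by
  have := finC1 hA hB
  have e1 := rank_nullity hA hB
  have e2 := rankC1 hA hB
  have e3 : Module.finrank k (LinearMap.range (DD A B)) ≤ Module.finrank k (C1 A B) :=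
    Submodule.finrank_le _
  rw [ext_iff_DS, DS, ← LinearMap.range_eq_top]
  unfold euler
  rw [← e1, ← e2]
  constructor
  · intro h
    rw [h, finrank_top]
    ring
  · intro h
    apply Submodule.eq_top_of_finrank_eq
    omega

theorem euler_add_left {R : Type} [CommRing R] (a b c : Q.V → R) :
    euler Q (a + b) c = euler Q a c + euler Q b c := by
  unfold euler
  simp only [Pi.add_apply, add_mul, Finset.sum_add_distrib]
  ring

theorem euler_add_right {R : Type} [CommRing R] (a b c : Q.V → R) :
    euler Q a (b + c) = euler Q a b + euler Q a c := by
  unfold euler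
  simp only [Pi.add_apply, mul_add, Finset.sum_add_distrib]
  ring

theorem euler_smul_right {R : Type} [CommRing R] (r : R) (a b : Q.V → R) :
    euler Q a (r • b) = r * euler Q a b := by
  unfold euler
  simp only [Pi.smul_apply, smul_eq_mul, mul_sub, Finset.mul_sum]
  congr 1 <;> exact Finset.sum_congr rfl fun _ _ => by ring

theorem euler_zero_left {R : Type} [CommRing R] (a : Q.V → R) : euler Q 0 a = 0 := by
  unfold euler
  simp

theorem hm_pos_iff {A B : RepC k Q} (hA : FinDim A) (hB : FinDim B) :
    0 < hm A B ↔ ∃ f : A ⟶ B, f ≠ 0 := by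
  have := finHom hA hB
  unfold hm
  rw [Module.finrank_pos_iff_exists_ne_zero]

theorem homZero_iff {A B : RepC k Q} (hA : FinDim A) (hB : FinDim B) :
    HomZero A B ↔ hm A B = 0 := by
  have h := hm_pos_iff hA hB
  constructor
  · intro h0
    by_contra hc
    obtain ⟨f, hf⟩ := h.1 (Nat.pos_of_ne_zero hc)
    exact hf (h0 f)
  · intro h0 f
    by_contra hc
    have := h.2 ⟨f, hc⟩
    omega

end Dims

section Fitting

variable {k : Type} [Field k] {Q : FinQuiver}

theorem ses_coker {A B : RepC k Q} (i : A ⟶ B) (hi : Mono i) :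
    (ShortComplex.mk i (cokernel.π i) (cokernel.condition i)).ShortExact :=
  ShortComplex.ShortExact.mk' (ShortComplex.exact_cokernel i) hi inferInstance

theorem ses_ker {A B : RepC k Q} (p : A ⟶ B) (hp : Epi p) :
    (ShortComplex.mk (kernel.ι p) p (kernel.condition p)).ShortExact :=
  ShortComplex.ShortExact.mk' (ShortComplex.exact_kernel p) inferInstance hp

theorem ses_biprod (A B : RepC k Q) :
    (ShortComplex.mk (biprod.inl : A ⟶ A ⊞ B) (biprod.snd : A ⊞ B ⟶ B) (by simp)).ShortExact :=
  (ShortComplex.Splitting.ofHasBinaryBiproduct A B).shortExact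

theorem factor {A B : RepC k Q} (f : A ⟶ B) : ∃ (I C : RepC k Q) (e : A ⟶ I) (m : I ⟶ B)
    (c : B ⟶ C) (w : m ≫ c = 0), Epi e ∧ e ≫ m = f ∧ (ShortComplex.mk m c w).ShortExact :=
  ⟨image f, cokernel (image.ι f), factorThruImage f, image.ι f, cokernel.π _, cokernel.condition _,
    inferInstance, image.fac f, ses_coker _ inferInstance⟩

theorem IsSummand.trans' {A B C : RepC k Q} (h : IsSummand A B) (h2 : IsSummand B C) :
    IsSummand A C := by
  obtain ⟨i, r, h⟩ := h
  obtain ⟨i', r', h'⟩ := h2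
  exact ⟨i ≫ i', r' ≫ r, by simp [reassoc_of% h', h]⟩

theorem summand_refl (A : RepC k Q) : IsSummand A A := ⟨𝟙 _, 𝟙 _, by simp⟩

theorem summand_iso {A B : RepC k Q} (e : A ≅ B) : IsSummand A B := ⟨e.hom, e.inv, by simp⟩

theorem summand_fd {A B : RepC k Q} (h : IsSummand A B) (hB : FinDim B) : FinDim A := by
  obtain ⟨i, r, h⟩ := h
  have : Mono i := mono_of_mono_fac h
  exact fd_of_mono i this hB

theorem ext_summand_right {A B X : RepC k Q} (h : IsSummand A B) (hB : Ext1Zero X B) :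
    Ext1Zero X A := by
  obtain ⟨i, r, h⟩ := h
  have : Epi r := epi_of_epi_fac h
  exact ext_quot hB r this

theorem ext_summand_left {A B X : RepC k Q} (h : IsSummand A B) (hB : Ext1Zero B X) :
    Ext1Zero A X := by
  obtain ⟨i, r, h⟩ := h
  have : Mono i := mono_of_mono_fac h
  exact ext_sub hB i this

theorem dimVec_mono_zero {A B : RepC k Q} (i : A ⟶ B) (hi : Mono i) (hB : FinDim B) {v : Q.V}
    (h : dimVec B v = 0) : dimVec A v = 0 := by
  have e := dimVec_ses (ses_coker i hi) hB
  have := congrFun e v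
  have h1 := dimVec_nonneg A v
  have h2 := dimVec_nonneg (cokernel i) v
  simp only [Pi.add_apply] at this
  omega

theorem dimVec_epi_zero {A B : RepC k Q} (i : A ⟶ B) (hi : Epi i) (hA : FinDim A) {v : Q.V}
    (h : dimVec A v = 0) : dimVec B v = 0 := by
  have e := dimVec_ses (ses_ker i hi) hA
  have := congrFun e v
  have h1 := dimVec_nonneg B v
  have h2 := dimVec_nonneg (kernel i) v
  simp only [Pi.add_apply] at this
  omega

theorem dimVec_summand_zero {A B : RepC k Q} (h : IsSummand A B) (hB : FinDim B) {v : Q.V}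
    (h : dimVec B v = 0) : dimVec A v = 0 := by
  obtain ⟨i, r, h'⟩ := ‹IsSummand A B›
  have : Mono i := mono_of_mono_fac h'
  exact dimVec_mono_zero i this hB h

theorem split_idem {U : RepC k Q} (hU : Indec U) (e : U ⟶ U) (he : e ≫ e = e) :
    e = 0 ∨ e = 𝟙 U := by
  obtain ⟨Y, i, r, h1, h2⟩ := IsIdempotentComplete.idempotents_split U e he
  obtain ⟨Z, i', r', h1', h2'⟩ := IsIdempotentComplete.idempotents_split U (𝟙 U - e) (by
    simp [he])
  have hz1 : i ≫ r' = 0 := by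
    have : i ≫ r' = i ≫ (r ≫ i) ≫ (r' ≫ i') ≫ r' := by
      simp [h1', reassoc_of% h1]
    rw [this, h2, h2']
    rw [← Category.assoc e]
    simp [he]
  have hz2 : i' ≫ r = 0 := by
    have : i' ≫ r = i' ≫ (r' ≫ i') ≫ (r ≫ i) ≫ r := by
      simp [h1, reassoc_of% h1']
    rw [this, h2, h2']
    rw [← Category.assoc _ e]
    simp [he]
  let φ : U ≅ Y ⊞ Z :=
    { hom := biprod.lift r r'
      inv := biprod.desc i i'
      hom_inv_id := by simp [h2, h2']
      inv_hom_id := by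
        apply biprod.hom_ext' <;> apply biprod.hom_ext <;> simp [h1, h1', hz1, hz2] }
  rcases hU.2 Y Z φ with h | h
  · left
    rw [← h2, h.eq_of_src i 0, comp_zero]
  · right
    have : 𝟙 U - e = 0 := by rw [← h2', h.eq_of_src i' 0, comp_zero]
    exact (sub_eq_zero.1 this).symm

theorem comm_fit {A : Type} [CommRing A] [IsArtinianRing A] (r : A) :
    ∃ (n : ℕ) (y : A), r ^ n * y ^ n * (r ^ n * y ^ n) = r ^ n * y ^ n ∧
      r ^ n = r ^ n * y ^ n * r ^ n ∧ r * (r ^ n * y ^ (n + 1)) = r ^ n * y ^ n := by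
  obtain ⟨n, y, h⟩ := IsArtinian.exists_pow_succ_smul_dvd r (1 : A)
  simp only [smul_eq_mul, mul_one] at h
  have h1 : ∀ j, r ^ n = r ^ n * (r * y) ^ j := by
    intro j
    induction j with
    | zero => simp
    | succ j ih =>
      calc r ^ n = r ^ (n + 1) * y := by rw [← h]; 
        _ = r ^ n * (r * y) := by ring
        _ = (r ^ n * (r * y) ^ j) * (r * y) := by rw [← ih]
        _ = _ := by ring
  have h2 : r ^ n = r ^ n * y ^ n * r ^ n := by
    conv_lhs => rw [h1 n]
    ring
  refine ⟨n, y, ?_, h2, ?_⟩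
  · calc _ = (r ^ n * y ^ n * r ^ n) * y ^ n := by ring
      _ = _ := by rw [← h2]
  · calc _ = (r ^ n * (r * y) ^ 1) * y ^ n := by ring
      _ = _ := by rw [← h1 1]

theorem loc_end {U : RepC k Q} (hfd : FinDim U) (hU : Indec U) (f : End U) :
    IsUnit f ∨ IsNilpotent f := by
  have : Module.Finite k (End U) := finHom hfd hfd
  let A := Algebra.adjoin k {f}
  have hc : IsMulCommutative A := Algebra.isMulCommutative_adjoin k (by
    intro a ha b hb
    simp only [Set.mem_singleton_iff] at ha hb
    rw [ha, hb])
  let iA : CommRing A := { (inferInstance : Ring A) with mul_comm := hc.is_comm.comm }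
  have : Module.Finite k A := inferInstanceAs (Module.Finite k (Subalgebra.toSubmodule A))
  have : IsArtinianRing A := IsArtinianRing.of_finite k A
  let r : A := ⟨f, Algebra.self_mem_adjoin_singleton k f⟩
  obtain ⟨n, y, h1, h2, h3⟩ := comm_fit r
  let e : End U := ((r ^ n * y ^ n : A) : End U)
  have he : e * e = e := congrArg Subtype.val h1
  have hr : (r : End U) = f := rfl
  rcases split_idem hU e he with h0 | h0
  · right
    refine ⟨n, ?_⟩
    have := congrArg Subtype.val h2
    have h5 : f ^ n = e * f ^ n := this
    rw [h5, h0]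
    exact zero_mul _
  · left
    have h5 : f * ((r ^ n * y ^ (n + 1) : A) : End U) = e := congrArg Subtype.val h3
    have h6 : ((r ^ n * y ^ (n + 1) : A) : End U) * f = e :=
      congrArg Subtype.val ((mul_comm _ _).trans h3)
    have h7 : e = 1 := h0
    exact ⟨⟨f, _, h5.trans h7, h6.trans h7⟩, rfl⟩

theorem isUnit_iso {U : RepC k Q} {f : End U} : IsUnit f ↔ IsIso (show U ⟶ U from f) := by
  constructor
  · intro h
    exact (isUnit_iff_isIso f).1 h
  · intro h
    exact (isUnit_iff_isIso f).2 h

theorem iso_of_fix {U B : RepC k Q} (hfd : FinDim U) (hU : Indec U) (f : U ⟶ U) (b : U ⟶ B)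
    (hb : b ≠ 0) (h : f ≫ b = b) : IsIso f := by
  rcases loc_end hfd hU f with h1 | ⟨n, hn⟩
  · exact isUnit_iso.1 h1
  · exfalso
    have key : ∀ n : ℕ, (show U ⟶ U from (show End U from f) ^ n) ≫ b = b := by
      intro n
      induction n with
      | zero => exact Category.id_comp b
      | succ n ih =>
        rw [pow_succ]
        change (f ≫ (show U ⟶ U from (show End U from f) ^ n)) ≫ b = b
        rw [Category.assoc, ih, h]
    have := key n
    rw [hn] at this
    exact hb (this.symm.trans zero_comp)

theorem unit_add {U : RepC k Q} (hfd : FinDim U) (hU : Indec U) (f g : End U)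
    (h : IsUnit (f + g)) : IsUnit f ∨ IsUnit g := by
  obtain ⟨u, hu⟩ := h
  rcases loc_end hfd hU (f * (↑u⁻¹ : End U)) with h1 | h1
  · left
    have := h1.mul u.isUnit
    rwa [mul_assoc, u.inv_mul, mul_one] at this
  · right
    have h2 := h1.isUnit_one_sub
    have h3 : 1 - f * (↑u⁻¹ : End U) = g * ↑u⁻¹ := by
      rw [sub_eq_iff_eq_add, add_comm, ← add_mul, ← hu, u.mul_inv]
    rw [h3] at h2
    have := h2.mul u.isUnit
    rwa [mul_assoc, u.inv_mul, mul_one] at this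

theorem unit_sum {U : RepC k Q} (hfd : FinDim U) (hU : Indec U) {ι : Type} (s : Finset ι)
    (f : ι → End U) (h : IsUnit (∑ i ∈ s, f i)) : ∃ i ∈ s, IsUnit (f i) := by
  classical
  induction s using Finset.induction_on with
  | empty =>
    exfalso
    rw [Finset.sum_empty] at h
    have h0 : (0 : End U) = 1 := by
      obtain ⟨u, hu⟩ := h
      have := u.mul_inv
      rw [hu, zero_mul] at this
      exact this
    apply hU.1
    rw [IsZero.iff_id_eq_zero]
    exact h0.symm
  | insert a s ha ih =>
    rw [Finset.sum_insert ha] at h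
    rcases unit_add hfd hU _ _ h with h | h
    · exact ⟨a, by simp, h⟩
    · obtain ⟨i, hi, h⟩ := ih h
      exact ⟨i, by simp [hi], h⟩

theorem iso_sum {U : RepC k Q} (hfd : FinDim U) (hU : Indec U) {ι : Type} (s : Finset ι)
    (f : ι → (U ⟶ U)) (h : ∑ i ∈ s, f i = 𝟙 U) : ∃ i ∈ s, IsIso (f i) := by
  have h1 : IsUnit (∑ i ∈ s, (show End U from f i)) := by
    have : (∑ i ∈ s, (show End U from f i)) = 1 := h
    rw [this]
    exact isUnit_one
  obtain ⟨i, hi, h2⟩ := unit_sum hfd hU s (fun i => (f i : End U)) h1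
  exact ⟨i, hi, isUnit_iso.1 h2⟩

def AddOf (R B : RepC k Q) : Prop :=
  ∃ (m : ℕ) (π : Fin m → (B ⟶ R)) (j : Fin m → (R ⟶ B)), ∑ i, π i ≫ j i = 𝟙 B

theorem addOf_summand {R B C : RepC k Q} (h : AddOf R B) (h2 : IsSummand C B) : AddOf R C := by
  obtain ⟨m, π, j, h⟩ := h
  obtain ⟨i, r, hi⟩ := h2
  refine ⟨m, fun t => i ≫ π t, fun t => j t ≫ r, ?_⟩
  have : i ≫ (∑ t, π t ≫ j t) ≫ r = 𝟙 C := by rw [h]; simpa using hi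
  rw [← this]
  simp [Preadditive.comp_sum, Preadditive.sum_comp]

theorem addOf_pow (R : RepC k Q) (m : ℕ) : AddOf R (⨁ fun _ : Fin m => R) :=
  ⟨m, fun t => biproduct.π _ t, fun t => biproduct.ι (fun _ : Fin m => R) t, biproduct.total⟩

theorem addOf_of_summand {R B : RepC k Q} (h : IsSummand B R) : AddOf R B := by
  obtain ⟨i, r, hi⟩ := h
  exact ⟨1, fun _ => i, fun _ => r, by simp [hi]⟩

theorem addOf_addSet {R B : RepC k Q} (h : B ∈ addSet ({R} : Set (RepC k Q))) : AddOf R B := by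
  obtain ⟨n, f, hf, h⟩ := h
  obtain rfl : f = fun _ => R := funext hf
  exact addOf_summand (addOf_pow R n) h

theorem addOf_ext_right {R B X : RepC k Q} (h : AddOf R B) (hX : Ext1Zero X R) :
    Ext1Zero X B := by
  obtain ⟨m, π, j, h⟩ := h
  exact ext_add_right Finset.univ (fun _ => R) π j h (fun _ _ => hX)

theorem addOf_ext_left {R B X : RepC k Q} (h : AddOf R B) (hX : Ext1Zero R X) :
    Ext1Zero B X := by
  obtain ⟨m, π, j, h⟩ := h
  exact ext_add_left Finset.univ (fun _ => R) π j h (fun _ _ => hX)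

theorem addOf_hz {R B X : RepC k Q} (h : AddOf R B) (hX : HomZero R X) :
    HomZero B X := by
  obtain ⟨m, π, j, h⟩ := h
  intro f
  rw [← Category.id_comp f, ← h, Preadditive.sum_comp]
  exact Finset.sum_eq_zero fun i _ => by rw [Category.assoc, hX (j i ≫ f), comp_zero]

theorem addOf_fd {R B : RepC k Q} (h : AddOf R B) (hR : FinDim R) : FinDim B := by
  obtain ⟨m, π, j, h⟩ := h
  have : Mono (biproduct.lift π) := by
    have e : biproduct.lift π ≫ biproduct.desc j = 𝟙 B := by rw [biproduct.lift_desc, h]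
    exact mono_of_mono_fac e
  refine fd_of_mono (biproduct.lift π) this ?_
  intro v
  have := hR v
  have hj : ∀ x : ob (⨁ fun _ : Fin m => R) v,
      (∀ t, ap (biproduct.π (fun _ : Fin m => R) t) v x = 0) → x = 0 := by
    intro x hx
    have h1 : ap (∑ t, biproduct.π (fun _ : Fin m => R) t ≫ biproduct.ι (fun _ => R) t) v x = x := by
      rw [biproduct.total]
      rfl
    have h2 : ∀ s : Finset (Fin m),
      ap (∑ t ∈ s, biproduct.π (fun _ : Fin m => R) t ≫ biproduct.ι (fun _ => R) t) v x = 0 := by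
      classical
      intro s
      induction s using Finset.induction_on with
      | empty => simp
      | insert a s ha ih =>
        rw [Finset.sum_insert ha, ap_add, LinearMap.add_apply, ih, ap_comp, LinearMap.comp_apply,
          hx a, map_zero, add_zero]
    rw [← h1, h2]
  let g : ob (⨁ fun _ : Fin m => R) v →ₗ[k] (Fin m → ob R v) :=
    LinearMap.pi fun t => ap (biproduct.π (fun _ : Fin m => R) t) v
  refine FiniteDimensional.of_injective g ?_
  rw [injective_iff_map_eq_zero]
  intro x hx
  exact hj x fun t => congrFun hx t

theorem addOf_dim {R B : RepC k Q} (h : AddOf R B) (hR : FinDim R) {v : Q.V}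
    (h0 : dimVec R v = 0) : dimVec B v = 0 := by
  have hB := addOf_fd h hR
  obtain ⟨m, π, j, h⟩ := h
  rw [dimVec_eq_zero_iff hR, ModuleCat.isZero_iff_subsingleton] at h0
  rw [dimVec_eq_zero_iff hB, ModuleCat.isZero_iff_subsingleton]
  have h2 : ∀ (s : Finset (Fin m)) (x : ob B v), ap (∑ t ∈ s, π t ≫ j t) v x = 0 := by
    classical
    intro s x
    induction s using Finset.induction_on with
    | empty => simp
    | insert a s ha ih =>
      rw [Finset.sum_insert ha, ap_add, LinearMap.add_apply, ih, ap_comp, LinearMap.comp_apply,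
        Subsingleton.elim (ap (π a) v x) 0, map_zero, add_zero]
  have h3 : ∀ x : ob B v, x = 0 := by
    intro x
    have := h2 Finset.univ x
    rw [h] at this
    exact this
  exact ⟨fun x y => (h3 x).trans (h3 y).symm⟩

theorem ks_add {R U : RepC k Q} (hfd : FinDim U) (hU : Indec U) (h : AddOf R U) :
    IsSummand U R := by
  obtain ⟨m, π, j, h⟩ := h
  obtain ⟨i, -, hi⟩ := iso_sum hfd hU Finset.univ (fun i => π i ≫ j i) h
  exact ⟨π i, j i ≫ inv (π i ≫ j i), by rw [← Category.assoc, IsIso.hom_inv_id]⟩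

theorem ks_biprod {A B U : RepC k Q} (hfd : FinDim U) (hU : Indec U) (h : IsSummand U (A ⊞ B)) :
    IsSummand U A ∨ IsSummand U B := by
  obtain ⟨i, r, h⟩ := h
  have h1 : i ≫ biprod.fst ≫ biprod.inl ≫ r + i ≫ biprod.snd ≫ biprod.inr ≫ r = 𝟙 U := by
    have : i ≫ (biprod.fst ≫ biprod.inl + biprod.snd ≫ biprod.inr) ≫ r = 𝟙 U := by
      rw [biprod.total]
      simpa using h
    rw [← this]
    simp only [Preadditive.comp_add, Preadditive.add_comp, Category.assoc]
  have hu : IsUnit ((show End U from i ≫ biprod.fst ≫ biprod.inl ≫ r) +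
      (show End U from i ≫ biprod.snd ≫ biprod.inr ≫ r)) := by
    have : ((show End U from i ≫ biprod.fst ≫ biprod.inl ≫ r) +
      (show End U from i ≫ biprod.snd ≫ biprod.inr ≫ r)) = 1 := h1
    rw [this]
    exact isUnit_one
  rcases unit_add hfd hU _ _ hu with h | h
  · left
    have := isUnit_iso.1 h
    refine ⟨i ≫ biprod.fst, (biprod.inl ≫ r) ≫ inv (i ≫ biprod.fst ≫ biprod.inl ≫ r), ?_⟩
    have := IsIso.hom_inv_id (i ≫ biprod.fst ≫ biprod.inl ≫ r)
    simpa only [Category.assoc] using this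
  · right
    have := isUnit_iso.1 h
    refine ⟨i ≫ biprod.snd, (biprod.inr ≫ r) ≫ inv (i ≫ biprod.snd ≫ biprod.inr ≫ r), ?_⟩
    have := IsIso.hom_inv_id (i ≫ biprod.snd ≫ biprod.inr ≫ r)
    simpa only [Category.assoc] using this

theorem iso_of_summand {U M : RepC k Q} (hU : ¬ IsZero U) (hM : Indec M) (h : IsSummand U M) :
    Nonempty (U ≅ M) := by
  obtain ⟨i, r, h⟩ := h
  rcases split_idem hM (r ≫ i) (by simp [reassoc_of% h]) with h0 | h0
  · exfalso
    apply hU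
    rw [IsZero.iff_id_eq_zero]
    have : i ≫ (r ≫ i) ≫ r = 𝟙 U := by simp [reassoc_of% h, h]
    rw [← this, h0]
    simp
  · exact ⟨⟨i, r, h, h0⟩⟩

theorem summand_inl (A B : RepC k Q) : IsSummand A (A ⊞ B) := ⟨biprod.inl, biprod.fst, by simp⟩
theorem summand_inr (A B : RepC k Q) : IsSummand B (A ⊞ B) := ⟨biprod.inr, biprod.snd, by simp⟩

theorem dec_ind (Φ : RepC k Q → Prop) (hz : ∀ X, IsZero X → Φ X)
    (hs : ∀ X A B, (X ≅ A ⊞ B) → Φ A → Φ B → Φ X) (E : RepC k Q) (hE : FinDim E)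
    (h : ∀ U, FinDim U → Indec U → IsSummand U E → Φ U) : Φ E := by
  obtain ⟨n, hn⟩ : ∃ n, td E ≤ n := ⟨_, le_rfl⟩
  induction n generalizing E with
  | zero => exact hz _ ((td_eq_zero_iff hE).1 (by omega))
  | succ n ih =>
    by_cases h0 : IsZero E
    · exact hz _ h0
    by_cases h1 : Indec E
    · exact h E hE h1 (summand_refl E)
    unfold Indec at h1
    push Not at h1
    obtain ⟨A, B, e, hA, hB⟩ := h1 h0
    have sA : IsSummand A E := (summand_inl A B).trans' (summand_iso e.symm)
    have sB : IsSummand B E := (summand_inr A B).trans' (summand_iso e.symm)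
    have fA := summand_fd sA hE
    have fB := summand_fd sB hE
    have t := td_ses (ses_biprod A B) (fd_of_mono e.inv inferInstance hE)
    have t2 : td E = td (A ⊞ B) := by
      have : (td E : ℤ) = td (A ⊞ B) := by
        rw [td_cast, td_cast, dimVec_iso e]
      exact_mod_cast this
    have pA : td A ≠ 0 := fun h => hA ((td_eq_zero_iff fA).1 h)
    have pB : td B ≠ 0 := fun h => hB ((td_eq_zero_iff fB).1 h)
    exact hs E A B e
      (ih A fA (fun U a b c => h U a b (c.trans' sA)) (by omega))
      (ih B fB (fun U a b c => h U a b (c.trans' sB)) (by omega))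

end Fitting

section Universal

variable {k : Type} [Field k] {Q : FinQuiver}

theorem homZero_ses {P A X C : RepC k Q} (hP : Projective P) {i : A ⟶ X} {c : X ⟶ C}
    {w : i ≫ c = 0} (h : (ShortComplex.mk i c w).ShortExact) :
    HomZero P X ↔ HomZero P A ∧ HomZero P C := by
  have hm : Mono i := h.mono_f
  have he : Epi c := h.epi_g
  constructor
  · intro h0
    refine ⟨fun f => ?_, fun g => ?_⟩
    · rw [← cancel_mono i, h0 (f ≫ i), zero_comp]
    · rw [← Projective.factorThru_comp g c, h0 (Projective.factorThru g c), zero_comp]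
  · rintro ⟨h1, h2⟩ f
    obtain ⟨g, hg⟩ : ∃ g : P ⟶ A, g ≫ i = f := by
      refine ⟨h.exact.lift f (h2 _), ?_⟩
      exact h.exact.lift_f f (h2 _)
    rw [← hg, h1 g, zero_comp]

theorem lemD {P : RepC k Q} {v : Q.V} (hP : IsProjAt P v) {X : RepC k Q} (hX : FinDim X) :
    HomZero P X ↔ dimVec X v = 0 := by
  obtain ⟨n, hn⟩ : ∃ n, td X ≤ n := ⟨_, le_rfl⟩
  induction n generalizing X with
  | zero =>
    have h0 : IsZero X := (td_eq_zero_iff hX).1 (by omega)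
    constructor
    · intro _
      rw [dimVec_isZero h0]
      rfl
    · intro _ f
      exact h0.eq_of_tgt f 0
  | succ n ih =>
    by_cases hs : Simple X
    · have := hP.2.2.2 X hX hs
      rw [dimVec_eq_zero_iff hX, ← not_iff_not, ← this]
      unfold HomZero
      push Not
      rfl
    by_cases h0 : IsZero X
    · constructor
      · intro _
        rw [dimVec_isZero h0]
        rfl
      · intro _ f
        exact h0.eq_of_tgt f 0
    obtain ⟨A, i, hi, hi0, hi1⟩ : ∃ (A : RepC k Q) (i : A ⟶ X), Mono i ∧ i ≠ 0 ∧ ¬ IsIso i := by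
      by_contra hc
      push Not at hc
      apply hs
      constructor
      intro Y f hf
      constructor
      · intro hiso h00
        apply h0
        rw [IsZero.iff_id_eq_zero, ← IsIso.inv_hom_id f]
        simp [h00]
      · exact hc Y f hf
    have hses := ses_coker i hi
    have fA := fd_of_mono i hi hX
    have fC := fd_of_epi (cokernel.π i) inferInstance hX
    have ht := td_ses hses hX
    have pA : td A ≠ 0 := fun h => hi0 (((td_eq_zero_iff fA).1 h).eq_of_src _ _)
    have pC : td (cokernel i) ≠ 0 := fun h => by
      apply hi1
      have hz := (td_eq_zero_iff fC).1 h
      have : Epi i := Preadditive.epi_of_cokernel_zero (hz.eq_of_tgt _ _)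
      exact isIso_of_mono_of_epi i
    rw [homZero_ses hP.2.2.1 hses, ih fA (by omega), ih fC (by omega)]
    have e := congrFun (dimVec_ses hses hX) v
    simp only [Pi.add_apply] at e
    have := dimVec_nonneg A v
    have := dimVec_nonneg (cokernel i) v
    omega

theorem lemD_ne {P : RepC k Q} {v : Q.V} (hP : IsProjAt P v) {X : RepC k Q} (hX : FinDim X)
    (h : dimVec X v ≠ 0) : ∃ f : P ⟶ X, f ≠ 0 := by
  by_contra hc
  push Not at hc
  exact h ((lemD hP hX).1 hc)

open scoped Classical in
/-- vertex spaces of the simple representation -/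
def simX (k : Type) [Field k] (Q : FinQuiver) (v w : Q.V) : ModuleCat.{0} k :=
  if w = v then ModuleCat.of k k else ModuleCat.of k PUnit.{1}

/-- the simple representation at a vertex -/
def simp1 (k : Type) [Field k] (Q : FinQuiver) (v : Q.V) : RepC k Q :=
  mkRep (simX k Q v) (fun _ => 0)

theorem simp1_fd (v : Q.V) : FinDim (simp1 k Q v) := by
  classical
  intro w
  change FiniteDimensional k (simX k Q v w)
  by_cases h : w = v
  · have e : simX k Q v w = ModuleCat.of k k := if_pos h
    exact e.symm ▸ (inferInstanceAs (Module.Finite k k))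
  · have e : simX k Q v w = ModuleCat.of k PUnit.{1} := if_neg h
    exact e.symm ▸ (inferInstanceAs (Module.Finite k PUnit.{1}))

theorem simp1_dim (v : Q.V) : dimVec (simp1 k Q v) = simRoot Q v := by
  classical
  funext w
  change (Module.finrank k (simX k Q v w) : ℤ) = simRoot Q v w
  unfold simRoot
  split_ifs with h
  · have e : simX k Q v w = ModuleCat.of k k := if_pos h
    refine (congrArg (fun M : ModuleCat.{0} k => (Module.finrank k M : ℤ)) e).trans ?_
    have : Module.finrank k (ModuleCat.of k k) = 1 := Module.finrank_self k
    simp only [this]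
    rfl
  · have e : simX k Q v w = ModuleCat.of k PUnit.{1} := if_neg h
    refine (congrArg (fun M : ModuleCat.{0} k => (Module.finrank k M : ℤ)) e).trans ?_
    have : Module.finrank k (ModuleCat.of k PUnit.{1}) = 0 :=
      Module.finrank_zero_of_subsingleton (R := k) (M := PUnit.{1})
    simp only [this]
    rfl

/-- postcomposition -/
def post (X : RepC k Q) {B C : RepC k Q} (p : B ⟶ C) : (X ⟶ B) →ₗ[k] (X ⟶ C) :=
  Linear.rightComp k X p

theorem post_apply (X : RepC k Q) {B C : RepC k Q} (p : B ⟶ C) (f : X ⟶ B) :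
    post X p f = f ≫ p := rfl

theorem hm_ses {X A B C : RepC k Q} (hX : FinDim X) (hB : FinDim B) {i : A ⟶ B} {p : B ⟶ C}
    {w : i ≫ p = 0} (h : (ShortComplex.mk i p w).ShortExact) :
    hm X B = hm X A + Module.finrank k (LinearMap.range (post X p)) := by
  have hmo : Mono i := h.mono_f
  have := finHom hX hB
  have e := LinearMap.finrank_range_add_finrank_ker (post X p)
  have hi : Function.Injective (post X i) := by
    intro f g hfg
    exact (cancel_mono i).1 hfg
  have e2 := LinearMap.finrank_range_of_inj hi
  have e3 : LinearMap.ker (post X p) = LinearMap.range (post X i) := by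
    ext f
    rw [LinearMap.mem_ker, LinearMap.mem_range]
    constructor
    · intro hf
      exact ⟨h.exact.lift f hf, h.exact.lift_f f hf⟩
    · rintro ⟨g, rfl⟩
      rw [post_apply, post_apply, Category.assoc, w, comp_zero]
  rw [e3, e2] at e
  unfold hm
  omega

theorem it_lemma {S : RepC k Q} (hS : FinDim S) (hr : Ext1Zero S S) (Φ : RepC k Q → Prop)
    (hΦ : ∀ (Y Y1 : RepC k Q) (i : Y ⟶ Y1) (p : Y1 ⟶ S) (w : i ≫ p = 0), FinDim Y → FinDim Y1 →
      Φ Y → (ShortComplex.mk i p w).ShortExact → Φ Y1)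
    (Y : RepC k Q) (hY : FinDim Y) (h0 : Φ Y) : ∃ E, FinDim E ∧ Φ E ∧ Ext1Zero S E := by
  obtain ⟨n, hn⟩ : ∃ n : ℕ, (hm S Y : ℤ) - euler Q (dimVec S) (dimVec Y) ≤ n :=
    ⟨_, Int.self_le_toNat _⟩
  induction n generalizing Y with
  | zero =>
    refine ⟨Y, hY, h0, (ext_iff_hm hS hY).2 ?_⟩
    have := euler_le_hm hS hY
    push_cast at hn
    omega
  | succ n ih =>
    by_cases hE : Ext1Zero S Y
    · exact ⟨Y, hY, h0, hE⟩
    unfold Ext1Zero at hE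
    push Not at hE
    obtain ⟨Y1, i, p, w, hs, hno⟩ := hE
    have hY1 := fd_of_ses hs hY hS
    refine ih Y1 hY1 (hΦ Y Y1 i p w hY hY1 h0 hs) ?_
    have e1 := hm_ses hS hY1 hs
    have e2 := (ext_iff_hm hS hS).1 hr
    have e3 : Module.finrank k (LinearMap.range (post S p)) < hm S S := by
      have := finHom hS hS
      refine Submodule.finrank_lt ?_
      intro htop
      obtain ⟨s, hsec⟩ := LinearMap.range_eq_top.1 htop (𝟙 S)
      obtain ⟨r, hr⟩ := retr_of_sec hs s hsec
      exact hno r hr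
    rw [dimVec_ses hs hY1, euler_add_right]
    push_cast at hn
    omega

theorem univ_exists {S Y : RepC k Q} (hS : FinDim S) (hY : FinDim Y) :
    ∃ (A : RepC k Q) (p : A ⟶ Y), AddOf S A ∧ ∀ f : S ⟶ Y, ∃ g : S ⟶ A, g ≫ p = f := by
  have := finHom hS hY
  let b := Module.finBasis k (S ⟶ Y)
  refine ⟨⨁ fun _ => S, biproduct.desc fun t => b t, addOf_pow S _, fun f => ?_⟩
  refine ⟨biproduct.lift fun t => (b.repr f t) • 𝟙 S, ?_⟩
  rw [biproduct.lift_desc]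
  conv_rhs => rw [← b.sum_repr f]
  refine Finset.sum_congr rfl fun t _ => ?_
  rw [Linear.smul_comp, Category.id_comp]

theorem ext_ker {S K A I : RepC k Q} (hS : FinDim S) (hA : FinDim A) {κ : K ⟶ A} {e : A ⟶ I}
    {w : κ ≫ e = 0} (h : (ShortComplex.mk κ e w).ShortExact) (hSA : Ext1Zero S A)
    (hl : ∀ f : S ⟶ I, ∃ g : S ⟶ A, g ≫ e = f) : Ext1Zero S K := by
  have hK := fd_of_mono κ h.mono_f hA
  have hI := fd_of_epi e h.epi_g hA
  have hSI := ext_quot hSA e h.epi_g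
  rw [ext_iff_hm hS hK]
  have e1 := hm_ses hS hA h
  have e2 := (ext_iff_hm hS hA).1 hSA
  have e3 := (ext_iff_hm hS hI).1 hSI
  rw [dimVec_ses h hA, euler_add_right] at e2
  have e4 : Module.finrank k (LinearMap.range (post S e)) = hm S I := by
    rw [LinearMap.range_eq_top.2 (fun f => hl f), finrank_top]
    rfl
  omega

theorem univ_map {S Y : RepC k Q} (hS : FinDim S) (hY : FinDim Y) (hSS : Ext1Zero S S)
    (hSY : Ext1Zero S Y) :
    ∃ (K A I F : RepC k Q) (κ : K ⟶ A) (e : A ⟶ I) (m : I ⟶ Y) (c : Y ⟶ F)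
      (w1 : κ ≫ e = 0) (w2 : m ≫ c = 0), AddOf S A ∧ (ShortComplex.mk κ e w1).ShortExact ∧
      (ShortComplex.mk m c w2).ShortExact ∧ HomZero S F ∧ Ext1Zero S F ∧ Ext1Zero S K ∧
      Ext1Zero S I := by
  obtain ⟨A, p, hA, hp⟩ := univ_exists hS hY
  obtain ⟨I, F, e, m, c, w, he, hem, hs⟩ := factor p
  have fA := addOf_fd hA hS
  have hSA := addOf_ext_right hA hSS
  have hSI := ext_quot hSA e he
  have hm : Mono m := hs.mono_f
  refine ⟨kernel e, A, I, F, kernel.ι e, e, m, c, kernel.condition e, w, hA, ses_ker e he, hs,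
    ?_, ext_quot hSY c hs.epi_g, ?_, hSI⟩
  · intro f
    obtain ⟨f', hf'⟩ := lift_of_ext hs hSI f
    obtain ⟨g, hg⟩ := hp f'
    rw [← hf', ← hg, ← hem, Category.assoc, Category.assoc, w, comp_zero, comp_zero]
  · refine ext_ker hS fA (ses_ker e he) hSA fun f => ?_
    obtain ⟨g, hg⟩ := hp (f ≫ m)
    refine ⟨g, ?_⟩
    rw [← cancel_mono m, ← hg, ← hem, Category.assoc]

theorem exists_L {P : Q.V → RepC k Q} (hP : ∀ v, IsProjAt (P v) v) (sh : Set Q.V) (v : Q.V) :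
    ∃ (L : RepC k Q) (q : P v ⟶ L), Epi q ∧ (∀ j ∈ sh, dimVec L j = 0) ∧
      (∀ X, FinDim X → (∀ j ∈ sh, dimVec X j = 0) → ∀ f : P v ⟶ X, ∃ g, q ≫ g = f) := by
  suffices H : ∀ (n : ℕ) (L : RepC k Q) (q : P v ⟶ L), Epi q →
      (∀ X, FinDim X → (∀ j ∈ sh, dimVec X j = 0) → ∀ f : P v ⟶ X, ∃ g, q ≫ g = f) → td L ≤ n →
      ∃ (L : RepC k Q) (q : P v ⟶ L), Epi q ∧ (∀ j ∈ sh, dimVec L j = 0) ∧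
      (∀ X, FinDim X → (∀ j ∈ sh, dimVec X j = 0) → ∀ f : P v ⟶ X, ∃ g, q ≫ g = f) from
    H _ (P v) (𝟙 _) inferInstance (fun X _ _ f => ⟨f, Category.id_comp f⟩) le_rfl
  intro n
  induction n with
  | zero =>
    intro L q hq hf hn
    refine ⟨L, q, hq, fun j _ => ?_, hf⟩
    have fL := fd_of_epi q hq (hP v).1
    rw [dimVec_isZero ((td_eq_zero_iff fL).1 (by omega))]
    rfl
  | succ n ih =>
    intro L q hq hf hn
    have fL := fd_of_epi q hq (hP v).1
    by_cases hz : ∀ j ∈ sh, dimVec L j = 0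
    · exact ⟨L, q, hq, hz, hf⟩
    push Not at hz
    obtain ⟨j, hj, hne⟩ := hz
    obtain ⟨g, hg⟩ := lemD_ne (hP j) fL hne
    obtain ⟨I, C, e, m, c, w, he, hem, hs⟩ := factor g
    have hc : Epi c := hs.epi_g
    refine ih C (q ≫ c) (epi_comp _ _) ?_ ?_
    · intro X hX hX0 f
      obtain ⟨f', hf'⟩ := hf X hX hX0 f
      have h0 : m ≫ f' = 0 := by
        rw [← cancel_epi e, ← Category.assoc, hem, comp_zero]
        exact (lemD (hP j) hX).2 (hX0 j hj) _
      refine ⟨hs.exact.desc f' h0, ?_⟩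
      rw [Category.assoc]
      have : c ≫ hs.exact.desc f' h0 = f' := hs.exact.g_desc f' h0
      rw [this, hf']
    · have t := td_ses hs fL
      have fI := fd_of_mono m hs.mono_f fL
      have : td I ≠ 0 := fun h => by
        apply hg
        rw [← hem, ((td_eq_zero_iff fI).1 h).eq_of_src m 0, comp_zero]
      omega

theorem ext_L {P : Q.V → RepC k Q} (hP : ∀ v, IsProjAt (P v) v) {sh : Set Q.V} {v : Q.V}
    {L : RepC k Q} {q : P v ⟶ L} (hq : Epi q) (hL : ∀ j ∈ sh, dimVec L j = 0)
    (hf : ∀ X, FinDim X → (∀ j ∈ sh, dimVec X j = 0) → ∀ f : P v ⟶ X, ∃ g, q ≫ g = f)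
    {X : RepC k Q} (hX : FinDim X) (hX0 : ∀ j ∈ sh, dimVec X j = 0) : Ext1Zero L X := by
  intro E i p w hs
  have fL := fd_of_epi q hq (hP v).1
  have fE := fd_of_ses hs hX fL
  have hE0 : ∀ j ∈ sh, dimVec E j = 0 := by
    intro j hj
    rw [dimVec_ses hs fE, Pi.add_apply, hX0 j hj, hL j hj]
    rfl
  have := (hP v).2.2.1
  have hp : Epi p := hs.epi_g
  obtain ⟨s, hs'⟩ := hf E fE hE0 (Projective.factorThru q p)
  refine retr_of_sec hs s ?_
  rw [← cancel_epi q, ← Category.assoc, hs', Projective.factorThru_comp, Category.comp_id]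

end Universal

section Bongartz

variable {k : Type} [Field k] {Q : FinQuiver}

/-- the class of objects `X` supported off `sh` with no extensions from `S` -/
structure TT (S : RepC k Q) (sh : Set Q.V) (X : RepC k Q) : Prop where
  fd : FinDim X
  ext : Ext1Zero S X
  z : ∀ j ∈ sh, dimVec X j = 0

theorem TT.quot {S X Y : RepC k Q} {sh : Set Q.V} (h : TT S sh X) (p : X ⟶ Y) (hp : Epi p) :
    TT S sh Y :=
  ⟨fd_of_epi p hp h.fd, ext_quot h.ext p hp, fun j hj => dimVec_epi_zero p hp h.fd (h.z j hj)⟩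

theorem TT.summand {S X Y : RepC k Q} {sh : Set Q.V} (h : TT S sh X) (hs : IsSummand Y X) :
    TT S sh Y :=
  ⟨summand_fd hs h.fd, ext_summand_right hs h.ext,
    fun j hj => dimVec_summand_zero hs h.fd (h.z j hj)⟩

theorem TT.addOf {S R Y : RepC k Q} {sh : Set Q.V} (h : TT S sh R) (hs : AddOf R Y) :
    TT S sh Y :=
  ⟨addOf_fd hs h.fd, addOf_ext_right hs h.ext, fun j hj => addOf_dim hs h.fd (h.z j hj)⟩

theorem dimz_ses {A B C : RepC k Q} {i : A ⟶ B} {p : B ⟶ C} {w : i ≫ p = 0}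
    (h : (ShortComplex.mk i p w).ShortExact) (hB : FinDim B) {j : Q.V} (h1 : dimVec A j = 0)
    (h2 : dimVec C j = 0) : dimVec B j = 0 := by
  rw [dimVec_ses h hB, Pi.add_apply, h1, h2]
  rfl

theorem bong {P : Q.V → RepC k Q} (hP : ∀ v, IsProjAt (P v) v) {S : RepC k Q} {sh : Set Q.V}
    (hS : TT S sh S) (v : Q.V) :
    ∃ E, TT S sh E ∧ (∀ X, TT S sh X → Ext1Zero E X) ∧
      (∀ F, TT S sh F → dimVec F v ≠ 0 → ∃ f : E ⟶ F, f ≠ 0) ∧ (v ∉ sh → dimVec E v ≠ 0) := by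
  obtain ⟨L, q, hq, hL, hf⟩ := exists_L hP sh v
  have fL := fd_of_epi q hq (hP v).1
  obtain ⟨E, fE, ⟨h1, h2, j, hj, h3⟩, hSE⟩ := it_lemma hS.fd hS.ext
    (fun Y => (∀ j ∈ sh, dimVec Y j = 0) ∧ (∀ X, TT S sh X → Ext1Zero Y X) ∧
      ∃ j : L ⟶ Y, Mono j ∧ ∀ F, TT S sh F → ∀ f : L ⟶ F, ∃ g : Y ⟶ F, j ≫ g = f) (by
    rintro Y Y1 i p w fY fY1 ⟨h1, h2, j, hj, h3⟩ hs
    refine ⟨fun t ht => dimz_ses hs fY1 (h1 t ht) (hS.z t ht), fun X hX =>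
      ext_ext_left hs (h2 X hX) hX.ext, j ≫ i, ?_, fun F hF f => ?_⟩
    · have := hs.mono_f
      exact mono_comp j i
    · obtain ⟨g, hg⟩ := h3 F hF f
      obtain ⟨g', hg'⟩ := extend_of_ext hs hF.ext g
      exact ⟨g', by rw [Category.assoc, hg', hg]⟩) L fL
    ⟨hL, fun X hX => ext_L hP hq hL hf hX.fd hX.z, 𝟙 L, inferInstance,
      fun F _ f => ⟨f, Category.id_comp f⟩⟩
  refine ⟨E, ⟨fE, hSE, h1⟩, h2, fun F hF hne => ?_, fun hv h0 => ?_⟩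
  · obtain ⟨f, hf0⟩ := lemD_ne (hP v) hF.fd hne
    obtain ⟨g, hg⟩ := hf F hF.fd hF.z f
    obtain ⟨g', hg'⟩ := h3 F hF g
    refine ⟨g', fun h => hf0 ?_⟩
    rw [← hg, ← hg', h, comp_zero, comp_zero]
  · have hL0 := dimVec_mono_zero j hj fE h0
    have hq0 : q = 0 := (lemD (hP v) fL).2 hL0 q
    obtain ⟨f, hf0⟩ := lemD_ne (hP v) (simp1_fd (k := k) v) (by
      rw [simp1_dim]
      simp [simRoot])
    obtain ⟨g, hg⟩ := hf _ (simp1_fd v) (by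
      intro t ht
      rw [simp1_dim]
      have : t ≠ v := fun h => hv (h ▸ ht)
      simp [simRoot, this]) f
    exact hf0 (by rw [← hg, hq0, zero_comp])

/-- generation condition -/
def GC (R : RepC k Q) (sh : Set Q.V) : Prop := ∀ F, TT R sh F → HomZero R F → IsZero F

theorem ses_comp_mono {K A I X : RepC k Q} {κ : K ⟶ A} {e : A ⟶ I} {w : κ ≫ e = 0}
    (h : (ShortComplex.mk κ e w).ShortExact) (m : I ⟶ X) (hm : IsIso m)
    (w' : κ ≫ e ≫ m = 0) : (ShortComplex.mk κ (e ≫ m) w').ShortExact := by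
  rw [ses_iff] at *
  intro v
  obtain ⟨h1, h2, h3⟩ := h v
  have m1 := (mono_iff_inj m).1 inferInstance v
  have m2 := (epi_iff_surj m).1 inferInstance v
  refine ⟨h1, ?_, ?_⟩
  · rw [ap_comp, LinearMap.coe_comp]
    exact m2.comp h2
  · intro y
    rw [ap_comp, LinearMap.comp_apply, ← h3 y, ← map_zero (ap m v), m1.eq_iff]

theorem app_lemma {R X : RepC k Q} {sh : Set Q.V} (hR : TT R sh R) (hX : TT R sh X)
    (hF : ∀ (F : RepC k Q) (c : X ⟶ F), Epi c → TT R sh F → HomZero R F → IsZero F) :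
    ∃ (K A : RepC k Q) (κ : K ⟶ A) (p : A ⟶ X) (w : κ ≫ p = 0), AddOf R A ∧
      (ShortComplex.mk κ p w).ShortExact ∧ TT R sh K := by
  obtain ⟨K, A, I, F, κ, e, m, c, w1, w2, hA, s1, s2, z, e1, e2, e3⟩ :=
    univ_map hR.fd hX.fd hR.ext hX.ext
  have hFz := hF F c s2.epi_g (hX.quot c s2.epi_g) z
  have hm : Mono m := s2.mono_f
  have hm2 : Epi m := by
    have : Epi (ShortComplex.mk m c w2).f := s2.exact.epi_f (hFz.eq_of_tgt _ _)
    exact this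
  have hm3 : IsIso m := isIso_of_mono_of_epi m
  have w' : κ ≫ e ≫ m = 0 := by rw [← Category.assoc, w1, zero_comp]
  have hTA := hR.addOf hA
  have hκ : Mono κ := s1.mono_f
  exact ⟨K, A, κ, e ≫ m, w', hA, ses_comp_mono s1 m hm3 w', ⟨fd_of_mono κ hκ hTA.fd, e2,
    fun j hj => dimVec_mono_zero κ hκ hTA.fd (hTA.z j hj)⟩⟩

theorem ct_of_gc {P : Q.V → RepC k Q} (hP : ∀ v, IsProjAt (P v) v) {T : CCObj k Q}
    (hT : TT T.r T.sh T.r) (hg : GC T.r T.sh) (hv : ∀ v, v ∉ T.sh → dimVec T.r v ≠ 0) :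
    IsClusterTilting P T := by
  refine ⟨⟨hT.ext, hT.ext, fun i hi => (lemD (hP i) hT.fd).2 (hT.z i hi),
    fun i hi => (lemD (hP i) hT.fd).2 (hT.z i hi)⟩, fun U fU iU h1 h2 h3 => ?_, fun j hj => ?_⟩
  · have hU : TT T.r T.sh U := ⟨fU, h1, fun j hj => (lemD (hP j) fU).1 (h3 j hj)⟩
    obtain ⟨K, A, κ, p, w, hA, hs, hK⟩ := app_lemma hT hU (fun F _ _ => hg F)
    obtain ⟨K', A', κ', p', w', hA', hs', hK'⟩ := app_lemma hT hK (fun F _ _ => hg F)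
    have hUK : Ext1Zero U K := ext_quot (addOf_ext_right hA' h2) p' hs'.epi_g
    obtain ⟨r, hr⟩ := hUK _ _ _ _ hs
    obtain ⟨s, hsec⟩ := sec_of_retr hs r hr
    exact ks_add fU iU (addOf_summand hA ⟨s, p, hsec⟩)
  · by_contra hc
    exact hv j hc ((lemD (hP j) hT.fd).1 hj)

theorem homZero_dec {R E F : RepC k Q} (fE : FinDim E)
    (h : ∀ U, FinDim U → Indec U → IsSummand U E → IsSummand U R) (hz : HomZero R F) :
    HomZero E F := by
  refine dec_ind (fun X => HomZero X F) (fun X hX f => hX.eq_of_src _ _) ?_ E fE ?_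
  · intro X A B e hA hB f
    rw [← cancel_epi e.inv, comp_zero]
    apply biprod.hom_ext'
    · rw [comp_zero]
      exact hA _
    · rw [comp_zero]
      exact hB _
  · intro U fU iU hU
    exact addOf_hz (addOf_of_summand (h U fU iU hU)) hz

theorem dimVec_biprod {A B : RepC k Q} (hA : FinDim A) (hB : FinDim B) :
    dimVec (A ⊞ B) = dimVec A + dimVec B :=
  dimVec_ses (ses_biprod A B) (fd_of_ses (ses_biprod A B) hA hB)

theorem dimz_dec {R E : RepC k Q} (fE : FinDim E) (fR : FinDim R)
    (h : ∀ U, FinDim U → Indec U → IsSummand U E → IsSummand U R) {v : Q.V}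
    (hz : dimVec R v = 0) : dimVec E v = 0 := by
  refine (dec_ind (fun X => FinDim X ∧ dimVec X v = 0) ?_ ?_ E fE ?_).2
  · intro X hX
    refine ⟨?_, by rw [dimVec_isZero hX]; rfl⟩
    intro v
    have := (isZero_iff_subs X).1 hX v
    infer_instance
  · rintro X A B e ⟨fA, hA⟩ ⟨fB, hB⟩
    refine ⟨fd_of_mono e.hom inferInstance (fd_of_ses (ses_biprod A B) fA fB), ?_⟩
    rw [dimVec_iso e, dimVec_biprod fA fB, Pi.add_apply, hA, hB]
    rfl
  · intro U fU iU hU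
    exact ⟨fU, dimVec_summand_zero (h U fU iU hU) fR hz⟩

theorem gc_of_bong {S R : RepC k Q} {sh : Set Q.V} (hSR : IsSummand S R)
    (E : Q.V → RepC k Q) (hE : ∀ v, FinDim (E v))
    (h1 : ∀ v F, TT S sh F → dimVec F v ≠ 0 → ∃ f : E v ⟶ F, f ≠ 0)
    (h3 : ∀ v U, FinDim U → Indec U → IsSummand U (E v) → IsSummand U R) : GC R sh := by
  intro F hF hz
  by_contra hc
  obtain ⟨v, hv⟩ := exists_dimVec_pos hF.fd hc
  obtain ⟨f, hf⟩ := h1 v F ⟨hF.fd, ext_summand_left hSR hF.ext, hF.z⟩ hv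
  exact hf (homZero_dec (hE v) (h3 v) hz f)

theorem ct_of_bong {P : Q.V → RepC k Q} (hP : ∀ v, IsProjAt (P v) v) {S : RepC k Q}
    {T : CCObj k Q} (hT : TT T.r T.sh T.r) (hSR : IsSummand S T.r)
    (E : Q.V → RepC k Q) (hE : ∀ v, FinDim (E v))
    (h1 : ∀ v F, TT S T.sh F → dimVec F v ≠ 0 → ∃ f : E v ⟶ F, f ≠ 0)
    (h2 : ∀ v, v ∉ T.sh → dimVec (E v) v ≠ 0)
    (h3 : ∀ v U, FinDim U → Indec U → IsSummand U (E v) → IsSummand U T.r) :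
    IsClusterTilting P T :=
  ct_of_gc hP hT (gc_of_bong hSR E hE h1 h3)
    fun v hv h0 => h2 v hv (dimz_dec (hE v) hT.fd (h3 v) h0)

theorem tt_of_ct {P : Q.V → RepC k Q} (hP : ∀ v, IsProjAt (P v) v) {T : CCObj k Q}
    (fT : FinDim T.r) (hT : CCExt1Zero P T T) : TT T.r T.sh T.r :=
  ⟨fT, hT.1, fun j hj => (lemD (hP j) fT).1 (hT.2.2.1 j hj)⟩

theorem ct_max {P : Q.V → RepC k Q} (hP : ∀ v, IsProjAt (P v) v) {T : CCObj k Q}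
    (hT : IsClusterTilting P T) {U : RepC k Q} (hU : TT T.r T.sh U) (iU : Indec U)
    (h : Ext1Zero U T.r) : IsSummand U T.r :=
  hT.2.1 U hU.fd iU hU.ext h fun i hi => (lemD (hP i) hU.fd).2 (hU.z i hi)

theorem gc_of_ct {P : Q.V → RepC k Q} (hP : ∀ v, IsProjAt (P v) v) {T : CCObj k Q}
    (fT : FinDim T.r) (hT : IsClusterTilting P T) : GC T.r T.sh := by
  have hTT := tt_of_ct hP fT hT.1
  choose E h1 h2 h3 h4 using bong hP hTT
  refine gc_of_bong (summand_refl T.r) E (fun v => (h1 v).fd) h3 fun v U fU iU hU => ?_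
  exact ct_max hP hT ((h1 v).summand hU) iU (ext_summand_left hU (h2 v _ hTT))

theorem wf_ind (Q : FinQuiver) (p : Q.V → Prop)
    (h : ∀ v, (∀ w, Nonempty (v ⟶ w) → p w) → p v) (v : Q.V) : p v := by
  let r : Q.V → Q.V → Prop := fun w v => ∃ p : Quiver.Path v w, p.length ≠ 0
  have : IsTrans Q.V r := ⟨by
    rintro a b c ⟨p, hp⟩ ⟨q, hq⟩
    refine ⟨q.comp p, ?_⟩
    rw [Quiver.Path.length_comp]
    omega⟩
  have : Std.Irrefl r := ⟨by
    rintro a ⟨p, hp⟩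
    rw [Q.acyclic a p] at hp
    exact hp rfl⟩
  have wf : WellFounded r := Finite.wellFounded_of_trans_of_irrefl r
  refine wf.induction v fun v ih => h v fun w ⟨a⟩ => ih w ⟨a.toPath, ?_⟩
  simp

theorem lemC {P : Q.V → RepC k Q} (hP : ∀ v, IsProjAt (P v) v) {T : CCObj k Q}
    (fT : FinDim T.r) (hT : IsClusterTilting P T) (x : Q.V → ℤ)
    (hx : ∀ U, FinDim U → Indec U → IsSummand U T.r → euler Q (dimVec U) x = 0)
    (hx2 : ∀ j ∈ T.sh, x j = 0) : x = 0 := by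
  have hTT := tt_of_ct hP fT hT.1
  have hG := gc_of_ct hP fT hT
  have s1 : ∀ K, TT T.r T.sh K → Ext1Zero K T.r → euler Q (dimVec K) x = 0 := by
    intro K hK hKT
    refine (dec_ind (fun X => FinDim X ∧ euler Q (dimVec X) x = 0) ?_ ?_ K hK.fd ?_).2
    · intro X hX
      refine ⟨?_, by rw [dimVec_isZero hX, euler_zero_left]⟩
      intro v
      have := (isZero_iff_subs X).1 hX v
      infer_instance
    · rintro X A B e ⟨fA, hA⟩ ⟨fB, hB⟩
      refine ⟨fd_of_mono e.hom inferInstance (fd_of_ses (ses_biprod A B) fA fB), ?_⟩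
      rw [dimVec_iso e, dimVec_biprod fA fB, euler_add_left, hA, hB]
      rfl
    · intro U fU iU hU
      exact ⟨fU, hx U fU iU (ct_max hP hT (hK.summand hU) iU (ext_summand_left hU hKT))⟩
  have s2 : ∀ Y, TT T.r T.sh Y → euler Q (dimVec Y) x = 0 := by
    intro Y hY
    obtain ⟨K, A, κ, p, w, hA, hs, hK⟩ := app_lemma hTT hY (fun F _ _ => hG F)
    have hAT := addOf_ext_left hA hTT.ext
    have e1 := s1 A (hTT.addOf hA) hAT
    have e2 := s1 K hK (ext_sub hAT κ hs.mono_f)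
    rw [dimVec_ses hs (hTT.addOf hA).fd, euler_add_left, e2, zero_add] at e1
    exact e1
  have s3 : ∀ Y : RepC k Q, FinDim Y → (∀ j ∈ T.sh, dimVec Y j = 0) → euler Q (dimVec Y) x = 0 := by
    intro Y fY hY
    obtain ⟨E, fE, ⟨h1, h2⟩, h3⟩ := it_lemma fT hTT.ext
      (fun Y' : RepC k Q => (∀ j ∈ T.sh, dimVec Y' j = 0) ∧ euler Q (dimVec Y') x = euler Q (dimVec Y) x) (by
        rintro Y' Y1 i p w fY' fY1 ⟨h1, h2⟩ hs
        refine ⟨fun j hj => dimz_ses hs fY1 (h1 j hj) (hTT.z j hj), ?_⟩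
        rw [dimVec_ses hs fY1, euler_add_left, h2, s2 _ hTT, add_zero]) Y fY ⟨hY, rfl⟩
    rw [← h2]
    exact s2 E ⟨fE, h3, h1⟩
  funext v
  refine wf_ind Q (fun v => x v = 0) (fun v ih => ?_) v
  by_cases hv : v ∈ T.sh
  · exact hx2 v hv
  have e := s3 (simp1 k Q v) (simp1_fd v) (by
    intro j hj
    rw [simp1_dim]
    have : j ≠ v := fun h => hv (h ▸ hj)
    simp [simRoot, this])
  rw [simp1_dim] at e
  unfold euler at e
  have e1 : ∑ w, simRoot Q v w * x w = x v := by
    classical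
    rw [Finset.sum_eq_single v]
    · simp [simRoot]
    · intro b _ hb
      simp [simRoot, hb]
    · intro h
      exact absurd (Finset.mem_univ v) h
  have e2 : ∑ a : (Σ x : Q.V, Σ y : Q.V, x ⟶ y), simRoot Q v a.1 * x a.2.1 = 0 := by
    refine Finset.sum_eq_zero fun a _ => ?_
    obtain ⟨a1, a2, a⟩ := a
    by_cases h : a1 = v
    · subst h
      rw [ih a2 ⟨a⟩, mul_zero]
    · simp [simRoot, h]
  rw [e1, e2, sub_zero] at e
  exact e

end Bongartz

section Main

variable {k : Type} [Field k] {Q : FinQuiver}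

/-- the right perpendicular objects -/
structure Perp (S : CCObj k Q) (X : RepC k Q) : Prop where
  tt : TT S.r S.sh X
  hz : HomZero S.r X

/-- generated by `S` -/
def GenS (S : CCObj k Q) (X : RepC k Q) : Prop :=
  ∃ A : RepC k Q, AddOf S.r A ∧ ∃ p : A ⟶ X, Epi p

/-- rank one property -/
def RankOne (S : CCObj k Q) : Prop := ∀ X Y : RepC k Q, Perp S X → Perp S Y → ¬ IsZero X →
  ¬ IsZero Y → ∃ a b : ℤ, 0 < a ∧ 0 < b ∧ a • dimVec X = b • dimVec Y

/-- the linear functional `euler a` -/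
def eulerL (a : Q.V → ℤ) : (Q.V → ℤ) →ₗ[ℤ] ℤ where
  toFun x := euler Q a x
  map_add' x y := euler_add_right a x y
  map_smul' r x := euler_smul_right r a x

theorem nct {P : Q.V → RepC k Q} (hP : ∀ v, IsProjAt (P v) v) {S : CCObj k Q}
    (fS : FinDim S.r) (hS : IsAlmostTilting P S) (v0 : Q.V) : ¬ IsClusterTilting P S := by
  classical
  intro hct
  obtain ⟨r, f, h1, h2, h3, h4⟩ := hS.2
  have hcard : 0 < Fintype.card Q.V := Fintype.card_pos_iff.2 ⟨v0⟩
  let Φ : (Q.V → ℤ) →ₗ[ℤ] ((Fin r ⊕ S.sh) → ℤ) := LinearMap.pi fun t =>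
    Sum.elim (fun i => eulerL (dimVec (f i))) (fun j : S.sh => LinearMap.proj (j : Q.V)) t
  have hinj : Function.Injective Φ := by
    rw [injective_iff_map_eq_zero]
    intro x hx
    refine lemC hP fS hct x (fun U fU iU hU => ?_) fun j hj => ?_
    · obtain ⟨i, ⟨e⟩⟩ := h3 U iU hU
      rw [dimVec_iso e]
      exact congrFun hx (Sum.inl i)
    · exact congrFun hx (Sum.inr ⟨j, hj⟩)
  have hle := LinearMap.finrank_le_finrank_of_injective hinj
  rw [Module.finrank_fintype_fun_eq_card, Module.finrank_fintype_fun_eq_card, Fintype.card_sum,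
    Fintype.card_fin] at hle
  have : Fintype.card S.sh = S.sh.ncard := by
    rw [← Nat.card_eq_fintype_card, Nat.card_coe_set_eq]
  omega

theorem ext_zero_right {N X : RepC k Q} (hX : IsZero X) : Ext1Zero N X :=
  fun _ _ _ _ _ => ⟨0, hX.eq_of_src _ _⟩

theorem perp_euler {S : CCObj k Q} (fS : FinDim S.r) {X U : RepC k Q} (hX : Perp S X)
    (hU : IsSummand U S.r) : euler Q (dimVec U) (dimVec X) = 0 := by
  have fU := summand_fd hU fS
  have h1 := (ext_iff_hm fU hX.tt.fd).1 (ext_summand_left hU hX.tt.ext)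
  rw [← h1, (homZero_iff fU hX.tt.fd).1 (addOf_hz (addOf_of_summand hU) hX.hz)]
  rfl

theorem rankOne_of_fun {S : CCObj k Q} (fS : FinDim S.r) (φ : (Q.V → ℤ) →ₗ[ℤ] ℤ)
    (hφ : ∀ x : Q.V → ℤ, (∀ U, FinDim U → Indec U → IsSummand U S.r → euler Q (dimVec U) x = 0) →
      (∀ j ∈ S.sh, x j = 0) → φ x = 0 → x = 0) : RankOne S := by
  intro X Y hX hY zX zY
  have hne : ∀ Z : RepC k Q, Perp S Z → ¬ IsZero Z → φ (dimVec Z) ≠ 0 := by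
    intro Z hZ zZ h0
    obtain ⟨v, hv⟩ := exists_dimVec_pos hZ.tt.fd zZ
    have := hφ (dimVec Z) (fun U _ _ hU => perp_euler fS hZ hU) hZ.tt.z h0
    rw [this] at hv
    exact hv rfl
  have key : φ (dimVec Y) • dimVec X = φ (dimVec X) • dimVec Y := by
    have : φ (dimVec Y) • dimVec X + (-φ (dimVec X)) • dimVec Y = 0 := by
      apply hφ
      · intro U fU iU hU
        rw [euler_add_right, euler_smul_right, euler_smul_right, perp_euler fS hX hU,
          perp_euler fS hY hU]
        ring
      · intro j hj
        simp [hX.tt.z j hj, hY.tt.z j hj]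
      · rw [map_add, map_smul, map_smul]
        simp only [smul_eq_mul]
        ring
    rw [neg_smul, ← sub_eq_add_neg, sub_eq_zero] at this
    exact this
  obtain ⟨v, hv⟩ := exists_dimVec_pos hX.tt.fd zX
  have hv0 := dimVec_nonneg X v
  have hy0 := dimVec_nonneg Y v
  have kv := congrFun key v
  simp only [Pi.smul_apply, smul_eq_mul] at kv
  have hvp : 0 < dimVec X v := lt_of_le_of_ne hv0 (Ne.symm hv)
  rcases lt_or_gt_of_ne (hne Y hY zY) with h | h
  · refine ⟨-φ (dimVec Y), -φ (dimVec X), by omega, ?_, by rw [neg_smul, neg_smul, key]⟩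
    by_contra hc
    have h1 : φ (dimVec Y) * dimVec X v < 0 := mul_neg_of_neg_of_pos h hvp
    have h2 : 0 ≤ φ (dimVec X) * dimVec Y v := mul_nonneg (by omega) hy0
    omega
  · refine ⟨φ (dimVec Y), φ (dimVec X), h, ?_, key⟩
    by_contra hc
    have h1 : 0 < φ (dimVec Y) * dimVec X v := mul_pos h hvp
    have h2 : φ (dimVec X) * dimVec Y v ≤ 0 := mul_nonpos_of_nonpos_of_nonneg (by omega) hy0
    omega

theorem rankOne {P : Q.V → RepC k Q} (hP : ∀ v, IsProjAt (P v) v) {S M : CCObj k Q}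
    (fS : FinDim S.r) (fM : FinDim M.r) (hM : IsComplement P S M) : RankOne S := by
  have fT : FinDim (CCSum S M).r := fd_of_ses (ses_biprod S.r M.r) fS fM
  rcases hM.1 with ⟨iM, hsh⟩ | ⟨zM, i, hsh⟩
  · refine rankOne_of_fun fS (eulerL (dimVec M.r)) fun x h1 h2 h3 => ?_
    refine lemC hP fT hM.2 x (fun U fU iU hU => ?_) fun j hj => ?_
    · rcases ks_biprod fU iU hU with h | h
      · exact h1 U fU iU h
      · obtain ⟨e⟩ := iso_of_summand iU.1 iM h
        rw [dimVec_iso e]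
        exact h3
    · have hj' : j ∈ S.sh ∪ M.sh := hj
      rw [hsh, Set.union_empty] at hj'
      exact h2 j hj'
  · refine rankOne_of_fun fS (LinearMap.proj i) fun x h1 h2 h3 => ?_
    refine lemC hP fT hM.2 x (fun U fU iU hU => ?_) fun j hj => ?_
    · rcases ks_biprod fU iU hU with h | ⟨a, b, h⟩
      · exact h1 U fU iU h
      · exfalso
        apply iU.1
        rw [IsZero.iff_id_eq_zero, ← h, zM.eq_of_src b 0, comp_zero]
    · have hj' : j ∈ S.sh ∪ M.sh := hj
      rw [hsh] at hj'
      rcases hj' with h | h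
      · exact h2 j h
      · rw [Set.mem_singleton_iff.1 h]
        exact h3

theorem perp_coker {S : CCObj k Q} {X I C : RepC k Q} (hX : Perp S X) {m : I ⟶ X} {c : X ⟶ C}
    {w : m ≫ c = 0} (hs : (ShortComplex.mk m c w).ShortExact) (hI : Ext1Zero S.r I) :
    Perp S C := by
  refine ⟨hX.tt.quot c hs.epi_g, fun g => ?_⟩
  obtain ⟨g', hg'⟩ := lift_of_ext hs hI g
  rw [← hg', hX.hz g', zero_comp]

theorem exists_perp {S : CCObj k Q} (tS : TT S.r S.sh S.r) {N : RepC k Q} (tN : TT S.r S.sh N)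
    (hN : ¬ GenS S N) : ∃ (F : RepC k Q) (c : N ⟶ F), Perp S F ∧ ¬ IsZero F ∧ Epi c := by
  obtain ⟨K, A, I, F, κ, e, m, c, w1, w2, hA, s1, s2, z, e1, e2, e3⟩ :=
    univ_map tS.fd tN.fd tS.ext tN.ext
  refine ⟨F, c, ⟨tN.quot c s2.epi_g, z⟩, fun hz => hN ⟨A, hA, e ≫ m, ?_⟩, s2.epi_g⟩
  have h1 : Epi m := by
    have : Epi (ShortComplex.mk m c w2).f := s2.exact.epi_f (hz.eq_of_tgt _ _)
    exact this
  have h2 : Epi e := s1.epi_g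
  exact epi_comp e m

theorem pos_lemma {S : CCObj k Q} (tS : TT S.r S.sh S.r) (hR : RankOne S) {N X : RepC k Q}
    (tN : TT S.r S.sh N) (hNN : Ext1Zero N N) (hN : ¬ GenS S N) (hX : Perp S X)
    (zX : ¬ IsZero X) : ∃ f : N ⟶ X, f ≠ 0 := by
  obtain ⟨F, c, hF, zF, hc⟩ := exists_perp tS tN hN
  have hNF := ext_quot hNN c hc
  have e1 := (ext_iff_hm tN.fd hF.tt.fd).1 hNF
  have p1 : 0 < hm N F := (hm_pos_iff tN.fd hF.tt.fd).2 ⟨c, fun h0 => by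
    apply zF
    rw [IsZero.iff_id_eq_zero, ← cancel_epi c, h0, zero_comp, zero_comp]⟩
  obtain ⟨a, b, ha, hb, hab⟩ := hR X F hX hF zX zF
  have e2 : a * euler Q (dimVec N) (dimVec X) = b * euler Q (dimVec N) (dimVec F) := by
    rw [← euler_smul_right, ← euler_smul_right, hab]
  rw [← e1] at e2
  have e3 : 0 < b * (hm N F : ℤ) := mul_pos hb (by exact_mod_cast p1)
  have e4 : 0 < euler Q (dimVec N) (dimVec X) := by
    rw [← e2] at e3
    exact (mul_pos_iff_of_pos_left ha).1 e3
  have e5 := euler_le_hm tN.fd hX.tt.fd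
  apply (hm_pos_iff tN.fd hX.tt.fd).1
  omega

theorem lemA {S : CCObj k Q} (tS : TT S.r S.sh S.r) (hR : RankOne S) {N : RepC k Q}
    (tN : TT S.r S.sh N) (hNN : Ext1Zero N N) (hNS : Ext1Zero N S.r) (hN : ¬ GenS S N)
    {X : RepC k Q} (hX : TT S.r S.sh X) : Ext1Zero N X := by
  have h1 : ∀ (n : ℕ) (X : RepC k Q), Perp S X → td X ≤ n → Ext1Zero N X := by
    intro n
    induction n with
    | zero =>
      intro X hX hn
      exact ext_zero_right ((td_eq_zero_iff hX.tt.fd).1 (by omega))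
    | succ n ih =>
      intro X hX hn
      by_cases zX : IsZero X
      · exact ext_zero_right zX
      obtain ⟨f, hf⟩ := pos_lemma tS hR tN hNN hN hX zX
      obtain ⟨I, C, e, m, c, w, he, hem, hs⟩ := factor f
      have tI := tN.quot e he
      have hC := perp_coker hX hs tI.ext
      have t := td_ses hs hX.tt.fd
      have : td I ≠ 0 := fun h => by
        apply hf
        rw [← hem, ((td_eq_zero_iff tI.fd).1 h).eq_of_src m 0, comp_zero]
      exact ext_ext_right hs (ext_quot hNN e he) (ih C hC (by omega))
  obtain ⟨K, A, I, F, κ, e, m, c, w1, w2, hA, s1, s2, z, e1, e2, e3⟩ :=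
    univ_map tS.fd hX.fd tS.ext hX.ext
  exact ext_ext_right s2 (ext_quot (addOf_ext_right hA hNS) e s1.epi_g)
    (h1 _ F ⟨hX.quot c s2.epi_g, z⟩ le_rfl)

/-- good objects -/
structure Good (S : CCObj k Q) (N : RepC k Q) : Prop where
  tt : TT S.r S.sh N
  ind : Indec N
  ext : ∀ X, TT S.r S.sh X → Ext1Zero N X
  ng : ¬ GenS S N

theorem exists_min {S : CCObj k Q} (tS : TT S.r S.sh S.r) {N : RepC k Q} (hN : Good S N) :
    ∃ B, Perp S B ∧ ¬ IsZero B ∧ ∀ X, Perp S X → ¬ IsZero X → td B ≤ td X := by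
  classical
  obtain ⟨F, c, hF, zF, -⟩ := exists_perp tS hN.tt hN.ng
  have hex : ∃ n : ℕ, ∃ X, Perp S X ∧ ¬ IsZero X ∧ td X = n := ⟨_, F, hF, zF, rfl⟩
  obtain ⟨B, hB, zB, hn⟩ := Nat.find_spec hex
  exact ⟨B, hB, zB, fun X hX zX => hn ▸ Nat.find_min' hex ⟨X, hX, zX, rfl⟩⟩

theorem lemL {S : CCObj k Q} (tS : TT S.r S.sh S.r) {B : RepC k Q} (hB : Perp S B)
    (hmin : ∀ X, Perp S X → ¬ IsZero X → td B ≤ td X) {N N2 : RepC k Q} (hN : Good S N)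
    (tN2 : TT S.r S.sh N2) (γ : N2 ⟶ B) (hγ : γ ≠ 0) (β : N ⟶ B) : ∃ f : N ⟶ N2, f ≫ γ = β := by
  have hepi : Epi γ := by
    obtain ⟨I, C, e, m, c, w, he, hem, hs⟩ := factor γ
    have tI := tN2.quot e he
    have hC := perp_coker hB hs tI.ext
    have t := td_ses hs hB.tt.fd
    have hI0 : td I ≠ 0 := fun h => by
      apply hγ
      rw [← hem, ((td_eq_zero_iff tI.fd).1 h).eq_of_src m 0, comp_zero]
    have zC : IsZero C := by
      by_contra hc
      have := hmin C hC hc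
      omega
    have h1 : Epi m := by
      have : Epi (ShortComplex.mk m c w).f := hs.exact.epi_f (zC.eq_of_tgt _ _)
      exact this
    rw [← hem]
    exact epi_comp e m
  have hs := ses_ker γ hepi
  have hK : TT S.r S.sh (kernel γ) :=
    ⟨fd_of_mono (kernel.ι γ) inferInstance tN2.fd,
      ext_ker tS.fd tN2.fd hs tN2.ext fun f => ⟨0, by rw [hB.hz f, zero_comp]⟩,
      fun j hj => dimVec_mono_zero (kernel.ι γ) inferInstance tN2.fd (tN2.z j hj)⟩
  exact lift_of_ext hs (hN.ext _ hK) β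

theorem lemU {S : CCObj k Q} (tS : TT S.r S.sh S.r) (hR : RankOne S) {N1 N2 : RepC k Q}
    (h1 : Good S N1) (h2 : Good S N2) : Nonempty (N1 ≅ N2) := by
  obtain ⟨B, hB, zB, hmin⟩ := exists_min tS h1
  obtain ⟨b1, hb1⟩ := pos_lemma tS hR h1.tt (h1.ext _ h1.tt) h1.ng hB zB
  obtain ⟨b2, hb2⟩ := pos_lemma tS hR h2.tt (h2.ext _ h2.tt) h2.ng hB zB
  obtain ⟨f, hf⟩ := lemL tS hB hmin h1 h2.tt b2 hb2 b1
  obtain ⟨g, hg⟩ := lemL tS hB hmin h2 h1.tt b1 hb1 b2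
  have i1 : IsIso (f ≫ g) := iso_of_fix h1.tt.fd h1.ind _ b1 hb1 (by rw [Category.assoc, hg, hf])
  have i2 : IsIso (g ≫ f) := iso_of_fix h2.tt.fd h2.ind _ b2 hb2 (by rw [Category.assoc, hf, hg])
  have : Mono f := mono_of_mono f g
  have : Epi f := epi_of_epi g f
  have : IsIso f := isIso_of_mono_of_epi f
  exact ⟨asIso f⟩

theorem addSet_of_addOf {R A : RepC k Q} (h : AddOf R A) : A ∈ addSet ({R} : Set (RepC k Q)) := by
  obtain ⟨m, π, j, h⟩ := h
  refine ⟨m, fun _ => R, fun _ => rfl, biproduct.lift π, biproduct.desc j, ?_⟩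
  rw [biproduct.lift_desc, h]

theorem addOf_mono {R R' A : RepC k Q} (h : AddOf R A) (hR : IsSummand R R') : AddOf R' A := by
  obtain ⟨m, π, j, h⟩ := h
  obtain ⟨i, r, hi⟩ := hR
  refine ⟨m, fun t => π t ≫ i, fun t => r ≫ j t, ?_⟩
  rw [← h]
  refine Finset.sum_congr rfl fun t _ => ?_
  rw [Category.assoc, reassoc_of% hi]

theorem compl_tt {P : Q.V → RepC k Q} (hP : ∀ v, IsProjAt (P v) v) {S M : CCObj k Q}
    (fM : FinDim M.r) (hM : IsComplement P S M) :
    TT S.r S.sh M.r ∧ Ext1Zero M.r M.r ∧ Ext1Zero M.r S.r := by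
  have h : Ext1Zero (S.r ⊞ M.r) (S.r ⊞ M.r) := hM.2.1.1
  have a := summand_inl S.r M.r
  have b := summand_inr S.r M.r
  refine ⟨⟨fM, ext_summand_left a (ext_summand_right b h), fun j hj => ?_⟩,
    ext_summand_left b (ext_summand_right b h), ext_summand_left b (ext_summand_right a h)⟩
  have : HomZero (P j) (S.r ⊞ M.r) := hM.2.1.2.2.1 j (Or.inl hj)
  rw [← lemD (hP j) fM]
  intro f
  have := this (f ≫ biprod.inr)
  rw [← Category.comp_id f, ← biprod.inr_snd (X := S.r), ← Category.assoc, this, zero_comp]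

theorem good_of_compl {P : Q.V → RepC k Q} (hP : ∀ v, IsProjAt (P v) v) {S M : CCObj k Q}
    (tS : TT S.r S.sh S.r) (fM : FinDim M.r) (hM : IsComplement P S M) (hsh : M.sh = ∅)
    (hng : ¬ GenS S M.r) : Good S M.r := by
  obtain ⟨h1, h2, h3⟩ := compl_tt hP fM hM
  refine ⟨h1, ?_, fun X hX => lemA tS (rankOne hP tS.fd fM hM) h1 h2 h3 hng hX, hng⟩
  rcases hM.1 with h | ⟨_, i, hi⟩
  · exact h.1
  · rw [hsh] at hi
    exact absurd hi (Set.singleton_ne_empty i).symm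

theorem ct_of_summand {P : Q.V → RepC k Q} {S M : CCObj k Q}
    (hSS : CCExt1Zero P S S) (hM : IsClusterTilting P (CCSum S M)) (iM : Indec M.r)
    (hsh : M.sh = ∅) (hs : IsSummand M.r S.r) : IsClusterTilting P S := by
  refine ⟨hSS, fun U fU iU h1 h2 h3 => ?_, fun j hj => ?_⟩
  · have hU : IsSummand U (S.r ⊞ M.r) := by
      refine hM.2.1 U fU iU ?_ ?_ ?_
      · exact ext_ext_left (ses_biprod S.r M.r) h1 (ext_summand_left hs h1)
      · exact ext_ext_right (ses_biprod S.r M.r) h2 (ext_summand_right hs h2)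
      · intro i hi
        have hi' : i ∈ S.sh ∪ M.sh := hi
        rw [hsh, Set.union_empty] at hi'
        exact h3 i hi'
    rcases ks_biprod fU iU hU with h | h
    · exact h
    · exact h.trans' hs
  · have hz : HomZero (P j) (S.r ⊞ M.r) := by
      intro f
      obtain ⟨i, r, hi⟩ := hs
      apply biprod.hom_ext
      · rw [zero_comp]
        exact hj _
      · rw [zero_comp, ← Category.comp_id (f ≫ biprod.snd), ← hi, ← Category.assoc,
          hj ((f ≫ biprod.snd) ≫ i), zero_comp]
    have : j ∈ S.sh ∪ M.sh := hM.2.2 j hz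
    rwa [hsh, Set.union_empty] at this

theorem sp_iff {P : Q.V → RepC k Q} (hP : ∀ v, IsProjAt (P v) v) {S M : CCObj k Q}
    (tS : TT S.r S.sh S.r) (hSS : CCExt1Zero P S S) (hn : ¬ IsClusterTilting P S)
    (fM : FinDim M.r) (hM : IsComplement P S M) :
    CCSplitProjGen M S ↔ M.sh = ∅ ∧ ¬ GenS S M.r := by
  constructor
  · rintro ⟨hsh, h1, h2⟩
    refine ⟨hsh, ?_⟩
    rintro ⟨A, hA, p, hp⟩
    have iM : Indec M.r := by
      rcases hM.1 with h | ⟨_, i, hi⟩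
      · exact h.1
      · rw [hsh] at hi
        exact absurd hi (Set.singleton_ne_empty i).symm
    have hAg : A ∈ gen ({(CCSum M S).r} : Set (RepC k Q)) :=
      ⟨A, addSet_of_addOf (addOf_mono hA (summand_inr M.r S.r)), 𝟙 A, inferInstance⟩
    obtain ⟨s, hs⟩ := h2 A hAg p hp
    exact hn (ct_of_summand hSS hM.2 iM hsh (ks_add fM iM (addOf_summand hA ⟨s, p, hs⟩)))
  · rintro ⟨hsh, hng⟩
    have hG := good_of_compl hP tS fM hM hsh hng
    have hR := rankOne hP tS.fd fM hM
    refine ⟨hsh, ⟨M.r, addSet_of_addOf (addOf_of_summand (summand_inl M.r S.r)), 𝟙 _,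
      inferInstance⟩, ?_⟩
    rintro X ⟨A, hA, q, hq⟩ p hp
    obtain ⟨B, hB, zB, hmin⟩ := exists_min tS hG
    obtain ⟨β, hβ⟩ := pos_lemma tS hR hG.tt (hG.ext _ hG.tt) hG.ng hB zB
    obtain ⟨m, π, j, hsum⟩ := addOf_addSet hA
    have hne : q ≫ p ≫ β ≠ 0 := by
      intro h0
      apply hβ
      rw [← cancel_epi p, ← cancel_epi q, h0, comp_zero, comp_zero]
    obtain ⟨t, ht⟩ : ∃ t, j t ≫ q ≫ p ≫ β ≠ 0 := by
      by_contra hc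
      push Not at hc
      apply hne
      rw [← Category.id_comp (q ≫ p ≫ β), ← hsum, Preadditive.sum_comp]
      exact Finset.sum_eq_zero fun t _ => by rw [Category.assoc, hc t, comp_zero]
    let jt : M.r ⊞ S.r ⟶ A := j t
    let φ : M.r ⟶ M.r := biprod.inl ≫ jt ≫ q ≫ p
    have hφ : φ ≫ β ≠ 0 := by
      intro h0
      apply ht
      change jt ≫ q ≫ p ≫ β = 0
      apply biprod.hom_ext'
      · rw [comp_zero, ← h0]
        simp only [φ, Category.assoc]
      · rw [comp_zero]
        exact hB.hz _
    obtain ⟨ψ, hψ⟩ := lemL tS hB hmin hG hG.tt (φ ≫ β) hφ β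
    have hi : IsIso (ψ ≫ φ) := iso_of_fix fM hG.ind _ β hβ (by rw [Category.assoc, hψ])
    refine ⟨inv (ψ ≫ φ) ≫ ψ ≫ biprod.inl ≫ jt ≫ q, ?_⟩
    have := IsIso.inv_hom_id (ψ ≫ φ)
    simp only [φ] at this ⊢
    simp only [Category.assoc] at this ⊢
    exact this

theorem good_of_bong {S : CCObj k Q} (tS : TT S.r S.sh S.r) {N : RepC k Q}
    (tN : TT S.r S.sh N) (iN : Indec N) (hext : ∀ X, TT S.r S.sh X → Ext1Zero N X)
    (hns : ¬ IsSummand N S.r) : Good S N := by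
  refine ⟨tN, iN, hext, ?_⟩
  rintro ⟨A0, hA0, p0, hp0⟩
  obtain ⟨K, A, κ, p, w, hA, hs, hK⟩ := app_lemma tS tN (by
    intro F c hc hF hz
    rw [IsZero.iff_id_eq_zero, ← cancel_epi c, ← cancel_epi p0]
    rw [addOf_hz hA0 hz (p0 ≫ c ≫ 𝟙 F), addOf_hz hA0 hz (p0 ≫ c ≫ 0)])
  obtain ⟨r, hr⟩ := hext K hK _ _ _ _ hs
  obtain ⟨s, hsec⟩ := sec_of_retr hs r hr
  exact hns (ks_add tN.fd iN (addOf_summand hA ⟨s, p, hsec⟩))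

theorem exists_good_compl {P : Q.V → RepC k Q} (hP : ∀ v, IsProjAt (P v) v) {S : CCObj k Q}
    (tS : TT S.r S.sh S.r) (hn : ¬ IsClusterTilting P S) (hR : RankOne S) :
    ∃ N : RepC k Q, Good S N ∧ IsComplement P S ⟨N, ∅⟩ := by
  choose E h1 h2 h3 h4 using bong hP tS
  by_cases hall : ∀ v U, FinDim U → Indec U → IsSummand U (E v) → IsSummand U S.r
  · exact absurd (ct_of_bong hP tS (summand_refl S.r) E (fun v => (h1 v).fd) h3 h4 hall) hn
  push Not at hall
  obtain ⟨v0, N, fN, iN, sN, nN⟩ := hall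
  have hgood : ∀ v U, FinDim U → Indec U → IsSummand U (E v) → ¬ IsSummand U S.r → Good S U := by
    intro v U fU iU sU nU
    exact good_of_bong tS ((h1 v).summand sU) iU
      (fun X hX => ext_summand_left sU (h2 v X hX)) nU
  have gN := hgood v0 N fN iN sN nN
  refine ⟨N, gN, Or.inl ⟨iN, rfl⟩, ?_⟩
  have e : CCSum S ⟨N, ∅⟩ = ⟨S.r ⊞ N, S.sh⟩ := by
    simp [CCSum]
  rw [e]
  have fT : FinDim (S.r ⊞ N) := fd_of_ses (ses_biprod S.r N) tS.fd fN
  refine ct_of_bong hP (S := S.r) (T := ⟨S.r ⊞ N, S.sh⟩) ⟨fT, ?_, ?_⟩ (summand_inl S.r N) E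
    (fun v => (h1 v).fd) h3 h4 ?_
  · have a1 : Ext1Zero S.r (S.r ⊞ N) := ext_ext_right (ses_biprod S.r N) tS.ext gN.tt.ext
    have a2 : Ext1Zero N (S.r ⊞ N) :=
      ext_ext_right (ses_biprod S.r N) (gN.ext _ tS) (gN.ext _ gN.tt)
    exact ext_ext_left (ses_biprod S.r N) a1 a2
  · intro j hj
    exact dimz_ses (ses_biprod S.r N) fT (tS.z j hj) (gN.tt.z j hj)
  · intro v U fU iU sU
    by_cases hU : IsSummand U S.r
    · exact hU.trans' (summand_inl S.r N)
    · obtain ⟨i⟩ := lemU tS hR (hgood v U fU iU sU hU) gN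
      exact (summand_iso i).trans' (summand_inr S.r N)

theorem genS_iso {S : CCObj k Q} {X Y : RepC k Q} (e : X ≅ Y) (h : GenS S Y) : GenS S X := by
  obtain ⟨A, hA, p, hp⟩ := h
  exact ⟨A, hA, p ≫ e.inv, epi_comp _ _⟩

end Main

/-- Let `S` be an almost tilting object in the cluster category
`CC_Q` and let `M` and `M*` be its two complements.  Then exactly one of the following
holds: `M` is split projective in `Gen(M ⊕ S)`, or `M*` is split projective in
`Gen(M* ⊕ S)`. -/
theorem statement12 (k : Type) [Field k] [IsAlgClosed k] (Q : FinQuiver)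
    (P : Q.V → RepC k Q) (hP : ∀ v, IsProjAt (P v) v)
    (hPall : ∀ X : RepC k Q, FinDim X → Indec X → Projective X →
      ∃ v, Nonempty (X ≅ P v))
    (S M M' : CCObj k Q) (hSfd : FinDim S.r) (hMfd : FinDim M.r) (hM'fd : FinDim M'.r)
    (hS : IsAlmostTilting P S)
    (hM : IsComplement P S M) (hM' : IsComplement P S M') (hne : ¬ CCIso M M')
    (hall : ∀ N : CCObj k Q, FinDim N.r → IsComplement P S N → CCIso N M ∨ CCIso N M') :
    Xor' (CCSplitProjGen M S) (CCSplitProjGen M' S) := by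
  have tS := tt_of_ct hP hSfd hS.1
  obtain ⟨v0⟩ : Nonempty Q.V := by
    rcases hM.1 with h | ⟨_, i, _⟩
    · obtain ⟨v, _⟩ := exists_dimVec_pos hMfd h.1.1
      exact ⟨v⟩
    · exact ⟨i⟩
  have hn := nct hP hSfd hS v0
  have hR := rankOne hP hSfd hMfd hM
  rw [sp_iff hP tS hS.1 hn hMfd hM, sp_iff hP tS hS.1 hn hM'fd hM']
  have hnot : ¬ ((M.sh = ∅ ∧ ¬ GenS S M.r) ∧ (M'.sh = ∅ ∧ ¬ GenS S M'.r)) := by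
    rintro ⟨⟨a1, a2⟩, b1, b2⟩
    exact hne ⟨lemU tS hR (good_of_compl hP tS hMfd hM a1 a2)
      (good_of_compl hP tS hM'fd hM' b1 b2), a1.trans b1.symm⟩
  obtain ⟨N, gN, cN⟩ := exists_good_compl hP tS hn hR
  rcases hall ⟨N, ∅⟩ gN.tt.fd cN with ⟨⟨e⟩, h⟩ | ⟨⟨e⟩, h⟩
  · have h1 : M.sh = ∅ ∧ ¬ GenS S M.r := ⟨h.symm, fun hg => gN.ng (genS_iso e hg)⟩
    exact Or.inl ⟨h1, fun h2 => hnot ⟨h1, h2⟩⟩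
  · have h1 : M'.sh = ∅ ∧ ¬ GenS S M'.r := ⟨h.symm, fun hg => gN.ng (genS_iso e hg)⟩
    exact Or.inr ⟨h1, fun h2 => hnot ⟨h2, h1⟩⟩
end NCPaper
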